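/- arXiv:0704.3293 — 10 statements merged into one kernel-verified Lean document; each statement's English description precedes it below -/
import Mathlib

section
/- Let S be a nonempty finite set, let p and q be probability distributions on S, and let q₀ denote the uniform distribution on S. Assume z := Σ_{x∈S} p(x)q(x) > 0 and define the probability distribution p̂ on S by p̂(x) = p(x)q(x)/z. Then ‖p̂ − p‖_TV ≤ 3·|S|²·‖q − q₀‖_TV. -/
/-- Each value of a zero-sum function is at most half of its `ℓ¹` norm. -/
theorem two_mul_abs_le_sum_abs_of_sum_eq_zero {S : Type*} [Fintype S]
    (f : S → ℝ) (hf : ∑ x, f x = 0) (x : S) : 2 * |f x| ≤ ∑ y, |f y| := by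
  classical
  have h := Finset.add_sum_erase Finset.univ f (Finset.mem_univ x)
  have h' := Finset.add_sum_erase Finset.univ (fun y => |f y|) (Finset.mem_univ x)
  have hle := Finset.abs_sum_le_sum_abs f (Finset.univ.erase x)
  have heq : f x = -∑ y ∈ Finset.univ.erase x, f y := by linarith
  have habs : |f x| = |∑ y ∈ Finset.univ.erase x, f y| := by rw [heq, abs_neg]
  linarith

/-- An average of a function lies within `r` of `c` when all its values do. -/
theorem abs_sum_mul_sub_le {S : Type*} [Fintype S] (p f : S → ℝ) (hp : ∀ x, 0 ≤ p x)
    (hp1 : ∑ x, p x = 1) (c r : ℝ) (h : ∀ x, |f x - c| ≤ r) :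
    |∑ x, p x * f x - c| ≤ r := by
  have heq : ∑ x, p x * f x - c = ∑ x, p x * (f x - c) := by
    simp only [mul_sub, Finset.sum_sub_distrib, ← Finset.sum_mul, hp1, one_mul]
  calc |∑ x, p x * f x - c| ≤ ∑ x, |p x * (f x - c)| := by
        rw [heq]; exact Finset.abs_sum_le_sum_abs _ _
    _ ≤ ∑ x, p x * r := by
        refine Finset.sum_le_sum fun x _ => ?_
        rw [abs_mul, abs_of_nonneg (hp x)]
        exact mul_le_mul_of_nonneg_left (h x) (hp x)
    _ = r := by rw [← Finset.sum_mul, hp1, one_mul]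

/-- Let `S` be a nonempty finite set, `p` and `q` probability
distributions on `S`, and `q₀` the uniform distribution on `S`.  If
`z := ∑ x, p x * q x > 0` and `p̂ x = p x * q x / z`, then
`‖p̂ − p‖_TV ≤ 3 |S|² ‖q − q₀‖_TV`, where
`‖p − q‖_TV = (1/2) ∑ x, |p x − q x|`. -/
theorem stmt_0 {S : Type*} [Fintype S] [Nonempty S]
    (p q : S → ℝ) (hp : ∀ x, 0 ≤ p x) (hq : ∀ x, 0 ≤ q x)
    (hp1 : ∑ x, p x = 1) (hq1 : ∑ x, q x = 1)
    (z : ℝ) (hz : z = ∑ x, p x * q x) (hzpos : 0 < z) :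
    (1 / 2) * ∑ x, |p x * q x / z - p x| ≤
      3 * (Fintype.card S : ℝ) ^ 2 *
        ((1 / 2) * ∑ x, |q x - 1 / (Fintype.card S : ℝ)|) := by
  have hN : (1 : ℝ) ≤ (Fintype.card S : ℝ) := by exact_mod_cast Fintype.card_pos
  set N : ℝ := (Fintype.card S : ℝ) with hNdef
  have hN0 : 0 < N := by linarith
  set D := ∑ x, |q x - 1 / N| with hD
  have hq_dist : ∀ x, |q x - 1 / N| ≤ D / 2 := by
    intro x
    have := two_mul_abs_le_sum_abs_of_sum_eq_zero (fun y => q y - 1 / N) (by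
      rw [Finset.sum_sub_distrib, hq1, Finset.sum_const, Finset.card_univ, nsmul_eq_mul,
        ← hNdef]
      field_simp
      ring) x
    simp only [← hD] at this
    linarith
  have hz_dist : |z - 1 / N| ≤ D / 2 := by
    rw [hz]
    exact abs_sum_mul_sub_le p q hp hp1 _ _ hq_dist
  have hD0 : 0 ≤ D := Finset.sum_nonneg fun x _ => abs_nonneg _
  rcases le_or_gt 1 (3 * N ^ 2 * z) with hlarge | hsmall
  · have hterm : ∀ x, |p x * q x / z - p x| ≤ p x * (D / z) := by
      intro x
      have heq : p x * q x / z - p x = p x * ((q x - z) / z) := by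
        field_simp
      rw [heq, abs_mul, abs_of_nonneg (hp x), abs_div, abs_of_pos hzpos]
      have hdist : |q x - z| ≤ D := by
        have := abs_sub_le (q x) (1 / N) z
        rw [abs_sub_comm (1 / N) z] at this
        linarith [hq_dist x]
      have := hp x
      gcongr
    have hsum : ∑ x, |p x * q x / z - p x| ≤ D / z := by
      refine (Finset.sum_le_sum fun x _ => hterm x).trans_eq ?_
      rw [← Finset.sum_mul, hp1, one_mul]
    have hdiv : D / z ≤ 3 * N ^ 2 * D := by
      rw [div_le_iff₀ hzpos]
      nlinarith
    linarith
  · have hsum : ∑ x, |p x * q x / z - p x| ≤ 2 := by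
      calc ∑ x, |p x * q x / z - p x| ≤ ∑ x, (p x * q x / z + p x) := by
            refine Finset.sum_le_sum fun x _ => ?_
            have h1 : 0 ≤ p x * q x / z := div_nonneg (mul_nonneg (hp x) (hq x)) hzpos.le
            have h2 := hp x
            rw [abs_le]
            constructor <;> linarith
        _ = 2 := by
            rw [Finset.sum_add_distrib, ← Finset.sum_div, ← hz, hp1, div_self hzpos.ne']
            norm_num
    have hgap : 1 / N - z ≤ D / 2 := by linarith [(abs_le.mp hz_dist).1]
    have hscaled := mul_le_mul_of_nonneg_left hgap (by positivity : 0 ≤ 3 * N ^ 2)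
    have hcancel : 3 * N ^ 2 * (1 / N - z) = 3 * N - 3 * N ^ 2 * z := by
      field_simp
    linarith
end

section
/- With the edge-disjoint decomposition setting as given, the marginal of μ on B satisfies ‖μ_B − μ^<‖_TV ≤ 3·|X|^{2|B|}·‖μ^>_D − ρ_D‖_TV, where ρ_D is the uniform distribution on X^D. -/
noncomputable section

open Finset

/-- Product over a set of (unordered) edges of the symmetric weights `ψ`,
evaluated at the configuration `x`. -/
def edgeW {V X : Type*} (ψ : V → V → X → X → ℝ)
    (hsym : ∀ i j a b, ψ i j a b = ψ j i b a)
    (E : Finset (Sym2 V)) (x : V → X) : ℝ :=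
  ∏ e ∈ E, Sym2.lift ⟨fun i j => ψ i j (x i) (x j),
    fun i j => hsym i j (x i) (x j)⟩ e

/-- The probability distribution on `X^V` proportional to the weight `W`. -/
def gibbs {V X : Type*} [Fintype V] [DecidableEq V] [Fintype X]
    (W : (V → X) → ℝ) (x : V → X) : ℝ :=
  W x / ∑ y : V → X, W y

/-- Marginal of a distribution `μ` on `X^V` on the subset `U` of vertices. -/
def marg {V X : Type*} [Fintype V] [DecidableEq V] [Fintype X] [DecidableEq X]
    (μ : (V → X) → ℝ) (U : Finset V) (y : {i // i ∈ U} → X) : ℝ :=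
  ∑ x : V → X, if ∀ i : {i // i ∈ U}, x i.1 = y i then μ x else 0


/-- The sum of the values at the configurations extending `y`, parametrised by their values
off `U`. -/
theorem marg_eq_sum_extend {V X : Type*} [Fintype V] [DecidableEq V] [Fintype X] [DecidableEq X]
    (W : (V → X) → ℝ) (U : Finset V) (y : {i // i ∈ U} → X) :
    marg W U y = ∑ w : {i // i ∉ U} → X,
      W ((Equiv.piEquivPiSubtypeProd (· ∈ U) (fun _ => X)).symm (y, w)) := by
  unfold marg
  rw [← (Equiv.piEquivPiSubtypeProd (· ∈ U) (fun _ => X)).symm.sum_comp, Fintype.sum_prod_type,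
    Finset.sum_comm]
  refine Finset.sum_congr rfl fun w _ => ?_
  have key : ∀ y' : {i // i ∈ U} → X, (∀ i : {i // i ∈ U},
      (Equiv.piEquivPiSubtypeProd (· ∈ U) (fun _ => X)).symm (y', w) i.1 = y i) ↔ y' = y := by
    intro y'
    simp [Equiv.piEquivPiSubtypeProd_symm_apply, funext_iff]
  simp only [key, Finset.sum_ite_eq', Finset.mem_univ, if_true]

theorem sum_marg {V X : Type*} [Fintype V] [DecidableEq V] [Fintype X] [DecidableEq X]
    (W : (V → X) → ℝ) (U : Finset V) : ∑ y, marg W U y = ∑ x, W x := by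
  simp only [marg_eq_sum_extend]
  rw [← (Equiv.piEquivPiSubtypeProd (· ∈ U) (fun _ => X)).symm.sum_comp, Fintype.sum_prod_type]

theorem marg_gibbs {V X : Type*} [Fintype V] [DecidableEq V] [Fintype X] [DecidableEq X]
    (W : (V → X) → ℝ) (U : Finset V) (y : {i // i ∈ U} → X) :
    marg (gibbs W) U y = marg W U y / ∑ x, W x := by
  simp only [marg_eq_sum_extend, gibbs, Finset.sum_div]

theorem marg_pos {V X : Type*} [Fintype V] [DecidableEq V] [Fintype X] [DecidableEq X]
    [Nonempty X] {W : (V → X) → ℝ} (hW : ∀ x, 0 < W x) (U : Finset V)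
    (y : {i // i ∈ U} → X) : 0 < marg W U y := by
  rw [marg_eq_sum_extend]
  exact Finset.sum_pos (fun _ _ => hW _) Finset.univ_nonempty

/-- Marginalising in two stages. -/
theorem marg_eq_sum_marg {V X : Type*} [Fintype V] [DecidableEq V] [Fintype X] [DecidableEq X]
    (W : (V → X) → ℝ) {D B : Finset V} (h : D ⊆ B) (z : {i // i ∈ D} → X) :
    marg W D z = ∑ y : {i // i ∈ B} → X,
      if ∀ i : {i // i ∈ D}, y ⟨i.1, h i.2⟩ = z i then marg W B y else 0 := by
  simp only [marg]
  have key : ∀ y : {i // i ∈ B} → X, (if ∀ i : {i // i ∈ D}, y ⟨i.1, h i.2⟩ = z i then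
      ∑ x : V → X, (if ∀ i : {i // i ∈ B}, x i.1 = y i then W x else 0) else 0) =
      ∑ x : V → X, if (fun i : {i // i ∈ B} => x i.1) = y then
        (if ∀ i : {i // i ∈ D}, x i.1 = z i then W x else 0) else 0 := by
    intro y
    split_ifs with hy
    · refine Finset.sum_congr rfl fun x _ => ?_
      simp only [funext_iff]
      by_cases h1 : ∀ i : {i // i ∈ B}, x i.1 = y i
      · rw [if_pos h1, if_pos h1, if_pos fun i => (h1 ⟨i.1, h i.2⟩).trans (hy i)]
      · rw [if_neg h1, if_neg h1]
    · symm
      refine Finset.sum_eq_zero fun x _ => ?_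
      split_ifs with h1 h2
      · exact absurd (h1 ▸ h2) hy
      · rfl
      · rfl
  simp only [key]
  rw [Finset.sum_comm]
  simp

/-- The number of configurations on `B` with prescribed values on `D` does not depend on those
values. -/
theorem card_restrict_fiber {V X : Type*} [DecidableEq V] [Fintype X] [DecidableEq X]
    {D B : Finset V} (h : D ⊆ B) (y : {i // i ∈ B} → X) :
    #{y' : {i // i ∈ B} → X | ∀ i : {i // i ∈ D}, y' ⟨i.1, h i.2⟩ = y ⟨i.1, h i.2⟩} =
      ∏ i : {i // i ∈ B}, if i.1 ∈ D then 1 else Fintype.card X := by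
  have : ({y' : {i // i ∈ B} → X | ∀ i : {i // i ∈ D}, y' ⟨i.1, h i.2⟩ = y ⟨i.1, h i.2⟩} :
      Finset ({i // i ∈ B} → X)) =
      Fintype.piFinset fun i => if i.1 ∈ D then {y i} else Finset.univ := by
    ext y'
    simp only [Finset.mem_filter, Finset.mem_univ, true_and, Fintype.mem_piFinset]
    constructor
    · intro hy i
      split_ifs with hi
      · simpa using hy ⟨i.1, hi⟩
      · simp
    · intro hy i
      simpa [i.2] using hy ⟨i.1, h i.2⟩
  rw [this, Fintype.card_piFinset]
  refine Finset.prod_congr rfl fun i _ => ?_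
  split_ifs <;> simp

theorem edgeW_pos {V X : Type*} {ψ : V → V → X → X → ℝ}
    (hsym : ∀ i j a b, ψ i j a b = ψ j i b a) (hpos : ∀ i j a b, 0 < ψ i j a b)
    (E : Finset (Sym2 V)) (x : V → X) : 0 < edgeW ψ hsym E x := by
  refine Finset.prod_pos fun e _ => ?_
  induction e with
  | h i j => exact hpos i j _ _

theorem edgeW_congr {V X : Type*} {ψ : V → V → X → X → ℝ}
    (hsym : ∀ i j a b, ψ i j a b = ψ j i b a) (E : Finset (Sym2 V)) {x x' : V → X}
    (h : ∀ e ∈ E, ∀ i ∈ e, x i = x' i) : edgeW ψ hsym E x = edgeW ψ hsym E x' := by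
  refine Finset.prod_congr rfl fun e he => ?_
  have := h e he
  induction e with
  | h i j =>
    simp only [Sym2.lift_mk]
    rw [this i (Sym2.mem_mk_left i j), this j (Sym2.mem_mk_right i j)]

/-- Reweighting a positive measure by a factor `f ∘ r` moves its normalisation, in `ℓ¹` distance,
by at most `2c` times the `ℓ¹` distance of `f` from the constant `1 / c`. -/
theorem sum_abs_reweight_sub_le {α β : Type*} [Fintype α] [Nonempty α] [Fintype β]
    {a g : α → ℝ} {f : β → ℝ} (r : α → β) {k c : ℝ} (ha : ∀ y, 0 < a y) (hf : ∀ z, 0 < f z)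
    (hk : 0 < k) (hc : 0 < c) (hg : ∀ y, g y = k * (a y * f (r y))) :
    ∑ y, |g y / ∑ y', g y' - a y / ∑ y', a y'| ≤ 2 * c * ∑ z, |f z - 1 / c| := by
  set A := ∑ y', a y' with hA
  have hApos : 0 < A := Finset.sum_pos (fun y _ => ha y) Finset.univ_nonempty
  set t := ∑ z, |f z - 1 / c| with ht
  set Z := ∑ y, a y * (c * f (r y)) with hZ
  have hZpos : 0 < Z :=
    Finset.sum_pos (fun y _ => mul_pos (ha y) (mul_pos hc (hf _))) Finset.univ_nonempty
  have hbound : ∀ y, |c * f (r y) - 1| ≤ c * t := by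
    intro y
    have : c * f (r y) - 1 = c * (f (r y) - 1 / c) := by field_simp
    rw [this, abs_mul, abs_of_pos hc]
    exact mul_le_mul_of_nonneg_left (Finset.single_le_sum (f := fun z => |f z - 1 / c|)
      (fun _ _ => abs_nonneg _) (Finset.mem_univ (r y))) hc.le
  have hdiff : ∑ y, a y * |c * f (r y) - 1| ≤ A * (c * t) := by
    rw [hA, Finset.sum_mul]
    exact Finset.sum_le_sum fun y _ => mul_le_mul_of_nonneg_left (hbound y) (ha y).le
  have hAZ : |A - Z| ≤ A * (c * t) := by
    refine le_trans ?_ hdiff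
    rw [abs_sub_comm, hZ, hA, ← Finset.sum_sub_distrib]
    refine (Finset.abs_sum_le_sum_abs _ _).trans_eq (Finset.sum_congr rfl fun y _ => ?_)
    rw [← mul_sub_one, abs_mul, abs_of_pos (ha y)]
  have hgsum : ∑ y, g y = k / c * Z := by
    rw [hZ, Finset.mul_sum]
    refine Finset.sum_congr rfl fun y _ => ?_
    rw [hg]
    field_simp
  have hterm : ∀ y, |g y / ∑ y', g y' - a y / A| ≤
      a y * (c * f (r y)) * (|A - Z| / (A * Z)) + a y * |c * f (r y) - 1| / A := by
    intro y
    have : g y / ∑ y', g y' - a y / A =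
        a y * (c * f (r y)) * ((A - Z) / (A * Z)) + a y * (c * f (r y) - 1) / A := by
      rw [hgsum, hg]
      field_simp
      ring
    rw [this]
    refine (abs_add_le _ _).trans_eq ?_
    rw [abs_mul, abs_div, abs_div, abs_mul (a y) (c * f (r y) - 1),
      abs_of_pos (mul_pos (ha y) (mul_pos hc (hf (r y)))), abs_of_pos (ha y),
      abs_of_pos hApos, abs_of_pos (mul_pos hApos hZpos)]
  calc ∑ y, |g y / ∑ y', g y' - a y / A|
      ≤ ∑ y, (a y * (c * f (r y)) * (|A - Z| / (A * Z)) + a y * |c * f (r y) - 1| / A) :=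
        Finset.sum_le_sum fun y _ => hterm y
    _ = |A - Z| / A + (∑ y, a y * |c * f (r y) - 1|) / A := by
        rw [Finset.sum_add_distrib, ← Finset.sum_mul, ← Finset.sum_div, ← hZ]
        field_simp
    _ ≤ A * (c * t) / A + A * (c * t) / A := by gcongr
    _ = 2 * c * t := by
        field_simp
        ring

/-- If `W₁` depends only on the values on `B` and `W₂` does not depend on the values on `B \ D`,
the marginal of `W₁ * W₂` on `B` is proportional to the marginal of `W₁` on `B` times that of `W₂`
on `D`. -/
theorem exists_marg_mul_eq {V X : Type*} [Fintype V] [DecidableEq V] [Fintype X] [DecidableEq X]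
    [Nonempty X] {W₁ W₂ : (V → X) → ℝ} {D B : Finset V} (h : D ⊆ B)
    (h₁ : ∀ x x' : V → X, (∀ i ∈ B, x i = x' i) → W₁ x = W₁ x')
    (h₂ : ∀ x x' : V → X, (∀ i, i ∉ B ∨ i ∈ D → x i = x' i) → W₂ x = W₂ x') :
    ∃ k : ℝ, 0 < k ∧ ∀ y : {i // i ∈ B} → X, marg (fun x => W₁ x * W₂ x) B y =
      k * (marg W₁ B y * marg W₂ D fun i => y ⟨i.1, h i.2⟩) := by
  set M : ℝ := ((Fintype.card ({i // i ∉ B} → X) : ℕ) : ℝ) with hM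
  set N : ℝ := ((∏ i : {i // i ∈ B}, if i.1 ∈ D then 1 else Fintype.card X : ℕ) : ℝ) with hN
  have hMpos : 0 < M := by
    rw [hM]
    exact_mod_cast Fintype.card_pos
  have hNpos : 0 < N := by
    rw [hN]
    refine Nat.cast_pos.2 (Finset.prod_pos fun i _ => ?_)
    split_ifs
    · exact one_pos
    · exact Fintype.card_pos
  refine ⟨1 / (M * N), by positivity, fun y => ?_⟩
  let w₀ : {i // i ∉ B} → X := Classical.arbitrary _
  set v := W₁ ((Equiv.piEquivPiSubtypeProd (· ∈ B) (fun _ => X)).symm (y, w₀)) with hv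
  have hW₁ : ∀ w, W₁ ((Equiv.piEquivPiSubtypeProd (· ∈ B) (fun _ => X)).symm (y, w)) = v := by
    intro w
    refine h₁ _ _ fun i hi => ?_
    simp [Equiv.piEquivPiSubtypeProd_symm_apply, hi]
  have e₁ : marg W₁ B y = M * v := by
    rw [marg_eq_sum_extend]
    simp only [hW₁, Finset.sum_const, Finset.card_univ, nsmul_eq_mul, hM]
  have e : marg (fun x => W₁ x * W₂ x) B y = v * marg W₂ B y := by
    simp only [marg_eq_sum_extend, hW₁, Finset.mul_sum]
  have e₂ : (marg W₂ D fun i => y ⟨i.1, h i.2⟩) = N * marg W₂ B y := by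
    rw [marg_eq_sum_marg W₂ h, ← Finset.sum_filter, hN, ← card_restrict_fiber h y, ← nsmul_eq_mul]
    refine Finset.sum_eq_card_nsmul fun y' hy' => ?_
    simp only [Finset.mem_filter, Finset.mem_univ, true_and] at hy'
    rw [marg_eq_sum_extend, marg_eq_sum_extend]
    refine Finset.sum_congr rfl fun w _ => h₂ _ _ fun i hi => ?_
    simp only [Equiv.piEquivPiSubtypeProd_symm_apply]
    split_ifs with hiB
    · exact hy' ⟨i, hi.resolve_left (not_not.2 hiB)⟩
    · rfl
  rw [e, e₁, e₂]
  field_simp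

/-- In the edge-disjoint decomposition setting,
`‖μ_B − μ^<‖_TV ≤ 3 |X|^{2|B|} ‖μ^>_D − ρ_D‖_TV`, where `ρ_D` is the uniform
distribution on `X^D`. -/
theorem stmt_2 {V X : Type*} [Fintype V] [DecidableEq V] [Fintype X]
    [DecidableEq X] [Nonempty X]
    (ψ : V → V → X → X → ℝ)
    (hsym : ∀ i j a b, ψ i j a b = ψ j i b a)
    (hpos : ∀ i j a b, 0 < ψ i j a b)
    (E E₁ E₂ : Finset (Sym2 V)) (hE : E = E₁ ∪ E₂) (hdisj : Disjoint E₁ E₂)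
    (B D : Finset V)
    (hB : ∀ e ∈ E₁, ∀ i ∈ e, i ∈ B)
    (hD : ∀ i : V, i ∈ D ↔ i ∈ B ∧ ∃ e ∈ E₂, i ∈ e)
    (hE₂ : ∀ e ∈ E₂, ∀ i ∈ e, i ∉ B ∨ i ∈ D) :
    (1 / 2) * ∑ y : {i // i ∈ B} → X,
        |marg (gibbs (edgeW ψ hsym E)) B y - marg (gibbs (edgeW ψ hsym E₁)) B y|
      ≤ 3 * (Fintype.card X : ℝ) ^ (2 * B.card) *
        ((1 / 2) * ∑ z : {i // i ∈ D} → X,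
          |marg (gibbs (edgeW ψ hsym E₂)) D z -
            1 / (Fintype.card X : ℝ) ^ D.card|) := by
  have hDB : D ⊆ B := fun i hi => ((hD i).1 hi).1
  have hmul : edgeW ψ hsym E = fun x => edgeW ψ hsym E₁ x * edgeW ψ hsym E₂ x := by
    funext x
    rw [hE]
    exact Finset.prod_union hdisj
  obtain ⟨k, hk, hkeq⟩ := exists_marg_mul_eq (W₁ := edgeW ψ hsym E₁) (W₂ := edgeW ψ hsym E₂) hDB
    (fun x x' hx => edgeW_congr hsym E₁ fun e he i hi => hx i (hB e he i hi))
    (fun x x' hx => edgeW_congr hsym E₂ fun e he i hi => hx i (hE₂ e he i hi))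
  rw [← hmul] at hkeq
  have hZ₂ : 0 < ∑ x, edgeW ψ hsym E₂ x :=
    Finset.sum_pos (fun x _ => edgeW_pos hsym hpos E₂ x) Finset.univ_nonempty
  have hq : (1 : ℝ) ≤ Fintype.card X := by exact_mod_cast Fintype.card_pos (α := X)
  have hmain := sum_abs_reweight_sub_le (a := marg (edgeW ψ hsym E₁) B)
    (g := marg (edgeW ψ hsym E) B) (f := marg (gibbs (edgeW ψ hsym E₂)) D)
    (fun y i => y ⟨i.1, hDB i.2⟩) (k := k * ∑ x, edgeW ψ hsym E₂ x)
    (c := (Fintype.card X : ℝ) ^ D.card) (marg_pos (edgeW_pos hsym hpos E₁) B)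
    (fun z => by
      rw [marg_gibbs]
      exact div_pos (marg_pos (edgeW_pos hsym hpos E₂) D z) hZ₂)
    (mul_pos hk hZ₂) (by positivity)
    (fun y => by
      rw [hkeq, marg_gibbs]
      field_simp)
  rw [sum_marg, sum_marg] at hmain
  simp only [← marg_gibbs] at hmain
  set t := ∑ z : {i // i ∈ D} → X, |marg (gibbs (edgeW ψ hsym E₂)) D z -
    1 / (Fintype.card X : ℝ) ^ D.card|
  have ht : 0 ≤ t := Finset.sum_nonneg fun _ _ => abs_nonneg _
  have hpow : (Fintype.card X : ℝ) ^ D.card ≤ (Fintype.card X : ℝ) ^ (2 * B.card) :=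
    pow_le_pow_right₀ hq ((Finset.card_le_card hDB).trans (by omega))
  have hmono := mul_le_mul_of_nonneg_right hpow ht
  have hnonneg : 0 ≤ (Fintype.card X : ℝ) ^ (2 * B.card) * t := by positivity
  linarith
end
end

section
/- Let X, Y, Z be random variables taking values in nonempty finite sets, defined on a common probability space, such that X and Z are conditionally independent given Y. Then ‖P_{(X,Z)} − P_X ⊗ P_Z‖_TV ≤ max_{y : P(Y=y)>0} ‖P_{X|Y=y} − P_X‖_TV, where P_{(X,Z)} is the joint law of (X,Z), P_X ⊗ P_Z the product of the marginal laws, and P_{X|Y=y} the conditional law of X given Y = y. -/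
/-- Summing the joint mass function of an event and a finite-valued random variable over all values
of the variable gives the mass of the event. -/
theorem sum_sum_ite_and_eq {Ω T : Type*} [Fintype Ω] [Fintype T] [DecidableEq T] (w : Ω → ℝ)
    (A : Ω → Prop) [DecidablePred A] (Y : Ω → T) :
    ∑ y, ∑ ω, (if A ω ∧ Y ω = y then w ω else 0) = ∑ ω, if A ω then w ω else 0 := by
  rw [Finset.sum_comm]
  refine Finset.sum_congr rfl fun ω _ => ?_
  by_cases h : A ω <;> simp [h]

/-- Averaging bound: if every term `D i` of positive weight is at most `M`, so is the weighted
average of `D`. -/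
theorem sum_mul_le_of_forall_pos {ι : Type*} [Fintype ι] {m D : ι → ℝ} {M : ℝ}
    (hm : ∀ i, 0 ≤ m i) (hm1 : ∑ i, m i = 1) (hD : ∀ i, 0 < m i → D i ≤ M) :
    ∑ i, m i * D i ≤ M :=
  calc ∑ i, m i * D i ≤ ∑ i, m i * M := by
        refine Finset.sum_le_sum fun i _ => ?_
        rcases (hm i).eq_or_lt with h | h
        · simp [← h]
        · exact mul_le_mul_of_nonneg_left (hD i h) h.le
    _ = M := by rw [← Finset.sum_mul, hm1, one_mul]

/-- The `ℓ¹` norm of a mixture `∑ y, f s y * b u y` is bounded by the average of the `ℓ¹` norms of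
the components `f · y`, weighted by the total mass of `b · y`. -/
theorem sum_sum_abs_sum_mul_le {S T U : Type*} [Fintype S] [Fintype T] [Fintype U]
    (f : S → T → ℝ) (b : U → T → ℝ) (hb : ∀ u y, 0 ≤ b u y) :
    ∑ s, ∑ u, |∑ y, f s y * b u y| ≤ ∑ y, (∑ u, b u y) * ∑ s, |f s y| :=
  calc ∑ s, ∑ u, |∑ y, f s y * b u y| ≤ ∑ s, ∑ u, ∑ y, |f s y| * b u y := by
        refine Finset.sum_le_sum fun s _ => Finset.sum_le_sum fun u _ => ?_
        refine (Finset.abs_sum_le_sum_abs _ _).trans_eq (Finset.sum_congr rfl fun y _ => ?_)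
        rw [abs_mul, abs_of_nonneg (hb u y)]
    _ = ∑ s, ∑ y, ∑ u, |f s y| * b u y := Finset.sum_congr rfl fun s _ => Finset.sum_comm
    _ = ∑ y, ∑ s, ∑ u, |f s y| * b u y := Finset.sum_comm
    _ = ∑ y, (∑ u, b u y) * ∑ s, |f s y| := by
        refine Finset.sum_congr rfl fun y _ => ?_
        rw [mul_comm, Finset.sum_mul_sum]

/-- Let `X, Z, Y` be random variables with values in nonempty
finite sets, defined on a common (finite) probability space, with `X` and `Z`
conditionally independent given `Y`.  Then
`‖P_{(X,Z)} − P_X ⊗ P_Z‖_TV ≤ max_{y : P(Y=y)>0} ‖P_{X|Y=y} − P_X‖_TV`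
(the maximum being expressed as a supremum over `{y // P(Y = y) > 0}`). -/
theorem stmt_4 {Ω S T U : Type*} [Fintype Ω] [Fintype S] [Fintype T] [Fintype U]
    [DecidableEq S] [DecidableEq T] [DecidableEq U]
    [Nonempty S] [Nonempty T] [Nonempty U]
    (w : Ω → ℝ) (hw : ∀ ω, 0 ≤ w ω) (hw1 : ∑ ω, w ω = 1)
    (X : Ω → S) (Y : Ω → T) (Z : Ω → U)
    (hCI : ∀ y : T, 0 < (∑ ω, if Y ω = y then w ω else 0) → ∀ (s : S) (u : U),
      (∑ ω, if X ω = s ∧ Z ω = u ∧ Y ω = y then w ω else 0) *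
          (∑ ω, if Y ω = y then w ω else 0) =
        (∑ ω, if X ω = s ∧ Y ω = y then w ω else 0) *
          (∑ ω, if Z ω = u ∧ Y ω = y then w ω else 0)) :
    (1 / 2) * (∑ s : S, ∑ u : U,
        |(∑ ω, if X ω = s ∧ Z ω = u then w ω else 0) -
          (∑ ω, if X ω = s then w ω else 0) * (∑ ω, if Z ω = u then w ω else 0)|)
      ≤ ⨆ y : {y : T // 0 < (∑ ω, if Y ω = y then w ω else 0)},
          (1 / 2) * ∑ s : S,
            |(∑ ω, if X ω = s ∧ Y ω = y.1 then w ω else 0) /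
                (∑ ω, if Y ω = y.1 then w ω else 0) -
              (∑ ω, if X ω = s then w ω else 0)| := by
  have nonneg (A : Ω → Prop) [DecidablePred A] : 0 ≤ ∑ ω, if A ω then w ω else 0 :=
    Finset.sum_nonneg fun ω _ => by split_ifs; exacts [hw ω, le_rfl]
  have mono (A B : Ω → Prop) [DecidablePred A] [DecidablePred B] (h : ∀ ω, A ω → B ω) :
      (∑ ω, if A ω then w ω else 0) ≤ ∑ ω, if B ω then w ω else 0 := by
    refine Finset.sum_le_sum fun ω _ => ?_
    by_cases hA : A ω
    · simp [hA, h ω hA]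
    · simp only [hA, if_false]
      split_ifs
      exacts [hw ω, le_rfl]
  set m : T → ℝ := fun y => ∑ ω, if Y ω = y then w ω else 0 with hm
  set a : S → T → ℝ := fun s y => ∑ ω, if X ω = s ∧ Y ω = y then w ω else 0
  set b : U → T → ℝ := fun u y => ∑ ω, if Z ω = u ∧ Y ω = y then w ω else 0 with hb
  set p : S → ℝ := fun s => ∑ ω, if X ω = s then w ω else 0
  have hm0 (y : T) : 0 ≤ m y := nonneg _
  have hm1 : ∑ y, m y = 1 := by
    simpa [hm, hw1] using sum_sum_ite_and_eq w (fun _ => True) Y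
  have hbm (y : T) : ∑ u, b u y = m y := by
    simpa only [hb, hm, and_comm] using sum_sum_ite_and_eq w (fun ω => Y ω = y) Z
  have hc (s : S) (u : U) (y : T) :
      (∑ ω, if (X ω = s ∧ Z ω = u) ∧ Y ω = y then w ω else 0) = a s y / m y * b u y := by
    simp only [and_assoc]
    rcases (hm0 y).eq_or_lt with h | h
    · rw [← h, div_zero, zero_mul]
      refine le_antisymm ?_ (nonneg _)
      exact (mono _ (fun ω => Y ω = y) fun ω hω => hω.2.2).trans_eq h.symm
    · rw [div_mul_eq_mul_div, eq_div_iff h.ne']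
      exact hCI y h s u
  have hdiff (s : S) (u : U) :
      (∑ ω, if X ω = s ∧ Z ω = u then w ω else 0) -
          p s * (∑ ω, if Z ω = u then w ω else 0) =
        ∑ y, (a s y / m y - p s) * b u y := by
    rw [← sum_sum_ite_and_eq w (fun ω => X ω = s ∧ Z ω = u) Y,
      ← sum_sum_ite_and_eq w (fun ω => Z ω = u) Y, Finset.mul_sum, ← Finset.sum_sub_distrib]
    exact Finset.sum_congr rfl fun y _ => by rw [hc, sub_mul]
  have hbound : ∑ s, ∑ u, |∑ y, (a s y / m y - p s) * b u y| ≤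
      ∑ y, m y * ∑ s, |a s y / m y - p s| := by
    simpa only [hbm] using
      sum_sum_abs_sum_mul_le (fun s y => a s y / m y - p s) b fun u y => nonneg _
  calc (1 / 2) * (∑ s, ∑ u, |(∑ ω, if X ω = s ∧ Z ω = u then w ω else 0) -
          p s * (∑ ω, if Z ω = u then w ω else 0)|)
      ≤ (1 / 2) * ∑ y, m y * ∑ s, |a s y / m y - p s| := by
        simp only [hdiff]
        gcongr
    _ = ∑ y, m y * ((1 / 2) * ∑ s, |a s y / m y - p s|) := by
        rw [Finset.mul_sum]
        exact Finset.sum_congr rfl fun y _ => mul_left_comm _ _ _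
    _ ≤ ⨆ y : {y : T // 0 < m y}, (1 / 2) * ∑ s, |a s y.1 / m y.1 - p s| :=
        sum_mul_le_of_forall_pos hm0 hm1 fun y hy =>
          le_ciSup (f := fun y : {y : T // 0 < m y} => (1 / 2) * ∑ s, |a s y.1 / m y.1 - p s|)
            (Set.finite_range _).bddAbove ⟨y, hy⟩
end

section
/- Let k ≥ 1 be an integer and let θ ∈ (0,1) and λ ∈ (0,1). Then |f_{θ,λ}^{∘t}(1) − f_{θ,λ}^{∘t}(0)| → 0 as t → ∞; that is, for every ε > 0 there exists T such that |f_{θ,λ}^{∘t}(1) − f_{θ,λ}^{∘t}(0)| ≤ ε for all t ≥ T. -/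
noncomputable section

/-- The tree recursion `f_{θ,λ}` for the Ising model on the `k`-ary tree. -/
def treeF (k : ℕ) (θ lam : ℝ) (h : ℝ) : ℝ :=
  ((1 + lam) * (1 + θ * h) ^ k - (1 - lam) * (1 - θ * h) ^ k) /
    ((1 + lam) * (1 + θ * h) ^ k + (1 - lam) * (1 - θ * h) ^ k)

theorem treeF_num_pos {k : ℕ} {θ lam h : ℝ} (hθ : θ ∈ Set.Ioo (0 : ℝ) 1)
    (hlam : lam ∈ Set.Ioo (0 : ℝ) 1) (hh : h ∈ Set.Icc (0 : ℝ) 1) :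
    0 < (1 + lam) * (1 + θ * h) ^ k ∧ 0 < (1 - lam) * (1 - θ * h) ^ k := by
  obtain ⟨h0, h1⟩ := hθ
  obtain ⟨l0, l1⟩ := hlam
  obtain ⟨a0, a1⟩ := hh
  have h2 : 0 < 1 - θ * h := by nlinarith
  have h3 : 0 < 1 - lam := by linarith
  constructor <;> positivity

theorem treeF_monotoneOn (k : ℕ) {θ lam : ℝ} (hθ : θ ∈ Set.Ioo (0 : ℝ) 1)
    (hlam : lam ∈ Set.Ioo (0 : ℝ) 1) : MonotoneOn (treeF k θ lam) (Set.Icc 0 1) := by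
  intro x hx y hy hxy
  obtain ⟨px, qx⟩ := treeF_num_pos (k := k) hθ hlam hx
  obtain ⟨py, qy⟩ := treeF_num_pos (k := k) hθ hlam hy
  have hm : θ * x ≤ θ * y := mul_le_mul_of_nonneg_left hxy hθ.1.le
  have hy1 : θ * y ≤ 1 := by nlinarith [hθ.1, hθ.2, hy.1, hy.2]
  have hx0 : 0 ≤ θ * x := mul_nonneg hθ.1.le hx.1
  have hp : (1 + lam) * (1 + θ * x) ^ k ≤ (1 + lam) * (1 + θ * y) ^ k :=
    mul_le_mul_of_nonneg_left (pow_le_pow_left₀ (by linarith) (by linarith) k)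
      (by linarith [hlam.1])
  have hq : (1 - lam) * (1 - θ * y) ^ k ≤ (1 - lam) * (1 - θ * x) ^ k :=
    mul_le_mul_of_nonneg_left (pow_le_pow_left₀ (by linarith) (by linarith) k)
      (by linarith [hlam.2])
  unfold treeF
  rw [div_le_div_iff₀ (by linarith) (by linarith)]
  nlinarith [mul_le_mul hp hq qy.le py.le]

theorem treeF_zero (k : ℕ) (θ lam : ℝ) : treeF k θ lam 0 = lam := by
  simp [treeF]
  ring

theorem treeF_lt_one {k : ℕ} {θ lam h : ℝ} (hθ : θ ∈ Set.Ioo (0 : ℝ) 1)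
    (hlam : lam ∈ Set.Ioo (0 : ℝ) 1) (hh : h ∈ Set.Icc (0 : ℝ) 1) :
    treeF k θ lam h < 1 := by
  obtain ⟨p, q⟩ := treeF_num_pos (k := k) hθ hlam hh
  rw [treeF, div_lt_one (by linarith)]
  linarith

theorem le_treeF {k : ℕ} {θ lam h : ℝ} (hθ : θ ∈ Set.Ioo (0 : ℝ) 1)
    (hlam : lam ∈ Set.Ioo (0 : ℝ) 1) (hh : h ∈ Set.Icc (0 : ℝ) 1) :
    lam ≤ treeF k θ lam h := by
  simpa only [treeF_zero] using treeF_monotoneOn k hθ hlam ⟨le_rfl, zero_le_one⟩ hh hh.1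

theorem treeF_mapsTo (k : ℕ) {θ lam : ℝ} (hθ : θ ∈ Set.Ioo (0 : ℝ) 1)
    (hlam : lam ∈ Set.Ioo (0 : ℝ) 1) :
    Set.MapsTo (treeF k θ lam) (Set.Icc 0 1) (Set.Icc 0 1) := fun _ hx =>
  ⟨hlam.1.le.trans (le_treeF hθ hlam hx), (treeF_lt_one hθ hlam hx).le⟩

theorem continuousAt_treeF {k : ℕ} {θ lam h : ℝ} (hθ : θ ∈ Set.Ioo (0 : ℝ) 1)
    (hlam : lam ∈ Set.Ioo (0 : ℝ) 1) (hh : h ∈ Set.Icc (0 : ℝ) 1) :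
    ContinuousAt (treeF k θ lam) h := by
  obtain ⟨p, q⟩ := treeF_num_pos (k := k) hθ hlam hh
  unfold treeF
  exact ContinuousAt.div (by fun_prop) (by fun_prop) (by linarith)

/-- Iterates of a monotone self-map of `[0,1]` started at an endpoint converge to a fixed point. -/
theorem exists_tendsto_iterate_isFixedPt {f : ℝ → ℝ}
    (hmaps : Set.MapsTo f (Set.Icc 0 1) (Set.Icc 0 1))
    (hmono : MonotoneOn f (Set.Icc 0 1)) (hcont : ∀ x ∈ Set.Icc (0 : ℝ) 1, ContinuousAt f x)
    {x : ℝ} (hx : x = 0 ∨ x = 1) :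
    ∃ a ∈ Set.Icc (0 : ℝ) 1, Function.IsFixedPt f a ∧
      Filter.Tendsto (fun n => f^[n] x) Filter.atTop (nhds a) := by
  have hxI : x ∈ Set.Icc (0 : ℝ) 1 := by rcases hx with rfl | rfl <;> simp
  have hmem (n : ℕ) : f^[n] x ∈ Set.Icc (0 : ℝ) 1 := hmaps.iterate n hxI
  have hlim : ∃ a, Filter.Tendsto (fun n => f^[n] x) Filter.atTop (nhds a) := by
    rcases hx with rfl | rfl
    · refine ⟨_, tendsto_atTop_ciSup (monotone_nat_of_le_succ fun n => ?_)
        ⟨1, Set.forall_mem_range.2 fun n => (hmem n).2⟩⟩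
      induction n with
      | zero => exact (hmem 1).1
      | succ n ih =>
        rw [Function.iterate_succ_apply' f n, Function.iterate_succ_apply' f (n + 1)]
        exact hmono (hmem n) (hmem (n + 1)) ih
    · refine ⟨_, tendsto_atTop_ciInf (antitone_nat_of_succ_le fun n => ?_)
        ⟨0, Set.forall_mem_range.2 fun n => (hmem n).1⟩⟩
      induction n with
      | zero => exact (hmem 1).2
      | succ n ih =>
        rw [Function.iterate_succ_apply' f n, Function.iterate_succ_apply' f (n + 1)]
        exact hmono (hmem (n + 1)) (hmem n) ih
  obtain ⟨a, ha⟩ := hlim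
  have haI : a ∈ Set.Icc (0 : ℝ) 1 := isClosed_Icc.mem_of_tendsto ha (.of_forall hmem)
  exact ⟨a, haI, isFixedPt_of_tendsto_iterate ha (hcont a haI), ha⟩

/-- A function vanishing at the fixed points of `treeF`, up to the additive constant
`log (1 + lam) - log (1 - lam)`. -/
def logGap (k : ℕ) (θ h : ℝ) : ℝ :=
  Real.log (1 + h) - Real.log (1 - h) - k * (Real.log (1 + θ * h) - Real.log (1 - θ * h))

theorem hasDerivAt_logGap (k : ℕ) {θ h : ℝ} (hθ : θ ∈ Set.Ioo (0 : ℝ) 1)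
    (hh : h ∈ Set.Ico (0 : ℝ) 1) :
    HasDerivAt (logGap k θ)
      (2 * ((1 - k * θ) + θ * (k - θ) * h ^ 2) / ((1 - h ^ 2) * (1 - (θ * h) ^ 2))) h := by
  obtain ⟨h0, h1⟩ := hθ
  obtain ⟨a0, a1⟩ := hh
  have e0 : 0 ≤ θ * h := by positivity
  have e1 : 0 < 1 - θ * h := by nlinarith
  have e2 : 0 < 1 - h := by linarith
  have n1 : 1 + h ≠ 0 := by positivity
  have n2 : 1 + θ * h ≠ 0 := by positivity
  have hid := hasDerivAt_id h
  have hmul := (hasDerivAt_id h).const_mul θ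
  have := (((hid.const_add 1).log n1).sub ((hid.const_sub 1).log e2.ne')).sub
    ((((hmul.const_add 1).log n2).sub ((hmul.const_sub 1).log e1.ne')).const_mul (k : ℝ))
  refine this.congr_deriv ?_
  simp only [id]
  rw [show 1 - h ^ 2 = (1 - h) * (1 + h) by ring,
    show 1 - (θ * h) ^ 2 = (1 - θ * h) * (1 + θ * h) by ring]
  have n3 : 1 - h * θ ≠ 0 := by rw [mul_comm]; exact e1.ne'
  field_simp
  ring

theorem logGap_eq_of_isFixedPt {k : ℕ} {θ lam h : ℝ} (hθ : θ ∈ Set.Ioo (0 : ℝ) 1)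
    (hlam : lam ∈ Set.Ioo (0 : ℝ) 1) (hh : h ∈ Set.Ico (0 : ℝ) 1)
    (hfix : Function.IsFixedPt (treeF k θ lam) h) :
    logGap k θ h = Real.log (1 + lam) - Real.log (1 - lam) := by
  obtain ⟨p, q⟩ := treeF_num_pos (k := k) hθ hlam (Set.Ico_subset_Icc_self hh)
  have e0 : 0 ≤ θ * h := mul_nonneg hθ.1.le hh.1
  have e1 : 0 < 1 - θ * h := by nlinarith [hθ.1, hθ.2, hh.1, hh.2]
  have e2 : 0 < 1 - h := by linarith [hh.2]
  have e3 : 0 < 1 + h := by linarith [hh.1]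
  have e4 : 0 < 1 + θ * h := by linarith
  have e5 : 0 < 1 - lam := by linarith [hlam.2]
  have e6 : 0 < 1 + lam := by linarith [hlam.1]
  have hfix' : treeF k θ lam h = h := hfix
  rw [treeF, div_eq_iff (by linarith)] at hfix'
  have key : (1 + h) * ((1 - lam) * (1 - θ * h) ^ k)
      = (1 - h) * ((1 + lam) * (1 + θ * h) ^ k) := by linarith
  have := congrArg Real.log key
  rw [Real.log_mul e3.ne' q.ne', Real.log_mul e2.ne' p.ne', Real.log_mul e5.ne' (by positivity),
    Real.log_mul e6.ne' (by positivity), Real.log_pow, Real.log_pow] at this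
  unfold logGap
  linarith

theorem logGap_ne_of_lt {k : ℕ} (hk : 1 ≤ k) {θ a b : ℝ} (hθ : θ ∈ Set.Ioo (0 : ℝ) 1)
    (ha : 0 < a) (hb : b < 1) (hab : a < b) (hpos : 0 < logGap k θ a) :
    logGap k θ a ≠ logGap k θ b := by
  intro heq
  have hderiv (x : ℝ) (hx : x ∈ Set.Icc 0 b) :=
    hasDerivAt_logGap k hθ (h := x) ⟨hx.1, hx.2.trans_lt hb⟩
  have hden (x : ℝ) (hx0 : 0 < x) (hx : x < b) : 0 < (1 - x ^ 2) * (1 - (θ * x) ^ 2) := by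
    have h1 : 0 < θ * x := mul_pos hθ.1 hx0
    have h2 : θ * x < 1 := by nlinarith [hθ.2]
    exact mul_pos (by nlinarith) (by nlinarith)
  obtain ⟨η, hη, hη'⟩ := exists_hasDerivAt_eq_slope (logGap k θ) _ ha
    (fun x hx => (hderiv x ⟨hx.1, hx.2.trans hab.le⟩).continuousAt.continuousWithinAt)
    (fun x hx => hderiv x ⟨hx.1.le, hx.2.le.trans hab.le⟩)
  obtain ⟨ξ, hξ, hξ'⟩ := exists_hasDerivAt_eq_zero hab
    (fun x hx => (hderiv x ⟨ha.le.trans hx.1, hx.2⟩).continuousAt.continuousWithinAt) heq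
    (fun x hx => hderiv x ⟨ha.le.trans hx.1.le, hx.2.le⟩)
  have dη := hden η hη.1 (hη.2.trans hab)
  have dξ := hden ξ (ha.trans hξ.1) hξ.2
  have hslope : 0 < (logGap k θ a - logGap k θ 0) / (a - 0) := by
    have h0 : logGap k θ 0 = 0 := by simp [logGap]
    rw [h0, sub_zero, sub_zero]
    positivity
  rw [← hη', div_pos_iff_of_pos_right dη] at hslope
  rw [div_eq_zero_iff, or_iff_left dξ.ne'] at hξ'
  have hk' : (1 : ℝ) ≤ k := by exact_mod_cast hk
  have hcoef : 0 < θ * (k - θ) := mul_pos hθ.1 (by linarith [hθ.2])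
  have hsq : η ^ 2 < ξ ^ 2 := pow_lt_pow_left₀ (hη.2.trans hξ.1) hη.1.le two_ne_zero
  nlinarith [mul_lt_mul_of_pos_left hsq hcoef]

theorem treeF_isFixedPt_mem_Ioo {k : ℕ} {θ lam h : ℝ} (hθ : θ ∈ Set.Ioo (0 : ℝ) 1)
    (hlam : lam ∈ Set.Ioo (0 : ℝ) 1) (hh : h ∈ Set.Icc (0 : ℝ) 1)
    (hfix : Function.IsFixedPt (treeF k θ lam) h) : h ∈ Set.Ioo (0 : ℝ) 1 := by
  rw [← hfix.eq]
  exact ⟨hlam.1.trans_le (le_treeF hθ hlam hh), treeF_lt_one hθ hlam hh⟩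

theorem treeF_isFixedPt_unique {k : ℕ} (hk : 1 ≤ k) {θ lam a b : ℝ}
    (hθ : θ ∈ Set.Ioo (0 : ℝ) 1) (hlam : lam ∈ Set.Ioo (0 : ℝ) 1)
    (ha : a ∈ Set.Icc (0 : ℝ) 1) (hb : b ∈ Set.Icc (0 : ℝ) 1)
    (hfa : Function.IsFixedPt (treeF k θ lam) a) (hfb : Function.IsFixedPt (treeF k θ lam) b) :
    a = b := by
  have ha' := treeF_isFixedPt_mem_Ioo hθ hlam ha hfa
  have hb' := treeF_isFixedPt_mem_Ioo hθ hlam hb hfb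
  have hga := logGap_eq_of_isFixedPt hθ hlam ⟨ha.1, ha'.2⟩ hfa
  have hgb := logGap_eq_of_isFixedPt hθ hlam ⟨hb.1, hb'.2⟩ hfb
  have hpos : 0 < Real.log (1 + lam) - Real.log (1 - lam) :=
    sub_pos.2 (Real.log_lt_log (by linarith [hlam.2]) (by linarith [hlam.1]))
  rcases lt_trichotomy a b with h | h | h
  · exact absurd (hga.trans hgb.symm) (logGap_ne_of_lt hk hθ ha'.1 hb'.2 h (hga ▸ hpos))
  · exact h
  · exact absurd (hgb.trans hga.symm) (logGap_ne_of_lt hk hθ hb'.1 ha'.2 h (hgb ▸ hpos))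

/-- For `k ≥ 1`, `θ ∈ (0,1)`, `λ ∈ (0,1)`,
`|f_{θ,λ}^{∘t}(1) − f_{θ,λ}^{∘t}(0)| → 0` as `t → ∞`. -/
theorem stmt_5 (k : ℕ) (hk : 1 ≤ k) (θ lam : ℝ)
    (hθ : θ ∈ Set.Ioo (0 : ℝ) 1) (hlam : lam ∈ Set.Ioo (0 : ℝ) 1) :
    ∀ ε > 0, ∃ T : ℕ, ∀ t ≥ T,
      |(treeF k θ lam)^[t] 1 - (treeF k θ lam)^[t] 0| ≤ ε := by
  intro ε hε
  have hmaps := treeF_mapsTo k hθ hlam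
  have hmono := treeF_monotoneOn k hθ hlam
  have hcont : ∀ x ∈ Set.Icc (0 : ℝ) 1, ContinuousAt (treeF k θ lam) x :=
    fun _ hx => continuousAt_treeF hθ hlam hx
  obtain ⟨a, ha, hfa, hta⟩ := exists_tendsto_iterate_isFixedPt hmaps hmono hcont (.inl rfl)
  obtain ⟨b, hb, hfb, htb⟩ := exists_tendsto_iterate_isFixedPt hmaps hmono hcont (.inr rfl)
  obtain rfl := treeF_isFixedPt_unique hk hθ hlam ha hb hfa hfb
  have hlim := (htb.sub hta).abs
  rw [sub_self, abs_zero] at hlim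
  exact Filter.eventually_atTop.1 (hlim.eventually_le_const hε)
end
end

section
/- Let k ≥ 1 be an integer and θ ∈ (0,1) with kθ ≤ 1. Then for every h ∈ [−1,1], f_{θ,0}^{∘t}(h) → 0 as t → ∞; that is, for every ε > 0 there exists T such that |f_{θ,0}^{∘t}(h)| ≤ ε for all t ≥ T and all h ∈ [−1,1]. -/
noncomputable section

/-- The main estimate, equivalent to `tanh (k * artanh x) ≤ k * x`. -/
theorem pow_sub_pow_le_mul_add {x : ℝ} (hx0 : 0 ≤ x) (hx1 : x ≤ 1) (k : ℕ) :
    (1 + x) ^ k - (1 - x) ^ k ≤ k * x * ((1 + x) ^ k + (1 - x) ^ k) := by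
  induction k with
  | zero => simp
  | succ k ih =>
    have hD : (1 - x) ^ k ≤ (1 + x) ^ k := pow_le_pow_left₀ (by linarith) (by linarith) k
    have h : 0 ≤ ((k : ℝ) + 1) * x * (x * ((1 + x) ^ k - (1 - x) ^ k)) :=
      mul_nonneg (by positivity) (mul_nonneg hx0 (by linarith))
    push_cast
    rw [pow_succ, pow_succ]
    linarith

/-- Strict form of `pow_sub_pow_le_mul_add` for exponents at least two. -/
theorem pow_sub_pow_lt_mul_add {x : ℝ} (hx0 : 0 < x) (hx1 : x ≤ 1) {k : ℕ} (hk : 2 ≤ k) :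
    (1 + x) ^ k - (1 - x) ^ k < k * x * ((1 + x) ^ k + (1 - x) ^ k) := by
  obtain ⟨k, rfl⟩ : ∃ m, k = m + 1 := ⟨k - 1, by omega⟩
  have hD : (1 - x) ^ k < (1 + x) ^ k :=
    pow_lt_pow_left₀ (by linarith) (by linarith) (by omega)
  have h : 0 < ((k : ℝ) + 1) * x * (x * ((1 + x) ^ k - (1 - x) ^ k)) :=
    mul_pos (by positivity) (mul_pos hx0 (by linarith))
  have ih := pow_sub_pow_le_mul_add hx0.le hx1 k
  push_cast
  rw [pow_succ, pow_succ]
  linarith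

theorem treeF_zero_neg (k : ℕ) (θ h : ℝ) : treeF k θ 0 (-h) = -treeF k θ 0 h := by
  simp only [treeF, add_zero, sub_zero, one_mul, mul_neg, sub_neg_eq_add, ← sub_eq_add_neg]
  rw [← neg_div, neg_sub, add_comm ((1 - θ * h) ^ k)]

theorem abs_treeF_zero_abs (k : ℕ) (θ h : ℝ) : |treeF k θ 0 (|h|)| = |treeF k θ 0 h| := by
  rcases abs_choice h with e | e <;> rw [e]
  rw [treeF_zero_neg, abs_neg]

theorem treeF_zero_denom_pos (k : ℕ) {θ h : ℝ} (hθ : θ ∈ Set.Ioo (0 : ℝ) 1) (hh : |h| ≤ 1) :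
    0 < (1 + 0) * (1 + θ * h) ^ k + (1 - 0) * (1 - θ * h) ^ k := by
  have hx : |θ * h| < 1 := by
    rw [abs_mul, abs_of_pos hθ.1]
    nlinarith [hθ.1, hθ.2]
  obtain ⟨h1, h2⟩ := abs_lt.1 hx
  have := pow_pos (show 0 < 1 + θ * h by linarith) k
  have := pow_pos (show 0 < 1 - θ * h by linarith) k
  linarith

/-- Away from the origin, the recursion strictly decreases the absolute value. -/
theorem abs_treeF_zero_lt {k : ℕ} (hk : 1 ≤ k) {θ h : ℝ} (hθ : θ ∈ Set.Ioo (0 : ℝ) 1)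
    (hkθ : (k : ℝ) * θ ≤ 1) (hh0 : h ≠ 0) (hh1 : |h| ≤ 1) : |treeF k θ 0 h| < |h| := by
  rw [← abs_treeF_zero_abs]
  have hden := treeF_zero_denom_pos k hθ ((abs_abs h).trans_le hh1)
  have hpos := abs_pos.2 hh0
  generalize |h| = y at *
  have hx0 : 0 < θ * y := mul_pos hθ.1 hpos
  have hx1 : θ * y ≤ 1 := by nlinarith [hθ.1, hθ.2]
  have hD : (1 - θ * y) ^ k ≤ (1 + θ * y) ^ k :=
    pow_le_pow_left₀ (by linarith) (by linarith) k
  rw [treeF, abs_of_nonneg (div_nonneg (by linarith) hden.le), div_lt_iff₀ hden]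
  simp only [add_zero, sub_zero, one_mul] at hden ⊢
  rcases hk.eq_or_lt with rfl | hk
  · nlinarith [hθ.2]
  · calc _ < k * (θ * y) * ((1 + θ * y) ^ k + (1 - θ * y) ^ k) :=
          pow_sub_pow_lt_mul_add hx0 hx1 hk
      _ = (k * θ) * (y * ((1 + θ * y) ^ k + (1 - θ * y) ^ k)) := by ring
      _ ≤ _ := mul_le_of_le_one_left (by positivity) hkθ

theorem abs_treeF_zero_le {k : ℕ} (hk : 1 ≤ k) {θ h : ℝ} (hθ : θ ∈ Set.Ioo (0 : ℝ) 1)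
    (hkθ : (k : ℝ) * θ ≤ 1) (hh1 : |h| ≤ 1) : |treeF k θ 0 h| ≤ |h| := by
  rcases eq_or_ne h 0 with rfl | h0
  · simp [treeF]
  · exact (abs_treeF_zero_lt hk hθ hkθ h0 hh1).le

/-- By compactness, the decrease is bounded below uniformly away from the origin. -/
theorem exists_abs_treeF_zero_add_le {k : ℕ} (hk : 1 ≤ k) {θ ε : ℝ}
    (hθ : θ ∈ Set.Ioo (0 : ℝ) 1) (hkθ : (k : ℝ) * θ ≤ 1) (hε : 0 < ε) :
    ∃ δ > 0, ∀ h : ℝ, ε ≤ |h| → |h| ≤ 1 → |treeF k θ 0 h| + δ ≤ |h| := by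
  have hcont : ContinuousOn (fun h => |h| - |treeF k θ 0 h|) (Set.Icc ε 1) := by
    refine continuousOn_id.abs.sub (ContinuousOn.abs ?_)
    unfold treeF
    refine ContinuousOn.div (by fun_prop) (by fun_prop) fun h hh => ?_
    exact (treeF_zero_denom_pos k hθ
      (by rw [abs_of_pos (hε.trans_le hh.1)]; exact hh.2)).ne'
  obtain ⟨δ, hδ, hle⟩ := isCompact_Icc.exists_forall_le' hcont (a := 0) fun h hh =>
    sub_pos.2 (abs_treeF_zero_lt hk hθ hkθ (hε.trans_le hh.1).ne'
      (by rw [abs_of_pos (hε.trans_le hh.1)]; exact hh.2))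
  refine ⟨δ, hδ, fun h h1 h2 => ?_⟩
  have := hle |h| ⟨h1, h2⟩
  rw [abs_abs, abs_treeF_zero_abs] at this
  linarith

/-- For `k ≥ 1`, `θ ∈ (0,1)` with `kθ ≤ 1`, the iterates
`f_{θ,0}^{∘t}(h)` tend to `0` uniformly over `h ∈ [−1,1]`. -/
theorem stmt_6 (k : ℕ) (hk : 1 ≤ k) (θ : ℝ)
    (hθ : θ ∈ Set.Ioo (0 : ℝ) 1) (hkθ : (k : ℝ) * θ ≤ 1) :
    ∀ ε > 0, ∃ T : ℕ, ∀ t ≥ T, ∀ h ∈ Set.Icc (-1 : ℝ) 1,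
      |(treeF k θ 0)^[t] h| ≤ ε := by
  intro ε hε
  obtain ⟨δ, hδ, hdec⟩ := exists_abs_treeF_zero_add_le hk hθ hkθ hε
  obtain ⟨T, hT⟩ := exists_nat_gt (1 / δ)
  rw [div_lt_iff₀ hδ] at hT
  refine ⟨T, fun t ht h hh => ?_⟩
  have key : ∀ n : ℕ, |(treeF k θ 0)^[n] h| ≤ 1 ∧
      |(treeF k θ 0)^[n] h| ≤ max ε (1 - n * δ) := by
    intro n
    induction n with
    | zero => simpa using ⟨abs_le.2 hh, Or.inr (abs_le.2 hh)⟩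
    | succ n ih =>
      obtain ⟨ih1, ih2⟩ := ih
      rw [Function.iterate_succ_apply']
      have hle := abs_treeF_zero_le hk hθ hkθ ih1
      refine ⟨hle.trans ih1, ?_⟩
      rcases le_total |(treeF k θ 0)^[n] h| ε with hs | hs
      · exact le_max_of_le_left (hle.trans hs)
      · have := hdec _ hs ih1
        push_cast
        rcases le_max_iff.1 ih2 with h' | h'
        · exact le_max_of_le_left (by linarith)
        · exact le_max_of_le_right (by linarith)
  have htT : (T : ℝ) * δ ≤ t * δ := by gcongr
  exact (key t).2.trans (max_le le_rfl (by linarith))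
end
end

section
/- Let k ≥ 1 be an integer, θ ∈ (0,1) and λ ∈ (0,1). Then f_{θ,λ} has exactly one fixed point in [0,1]: there exists a unique h* ∈ [0,1] with f_{θ,λ}(h*) = h*, and moreover h* ∈ (0,1). -/
noncomputable section

theorem treeF_eq_self_iff (k : ℕ) {θ lam h : ℝ} (hθ : θ ∈ Set.Ioo (0 : ℝ) 1)
    (hlam : lam ∈ Set.Ioo (0 : ℝ) 1) (hh : h ∈ Set.Icc (0 : ℝ) 1) :
    treeF k θ lam h = h ↔
      (1 - h) * ((1 + lam) * (1 + θ * h) ^ k) - (1 + h) * ((1 - lam) * (1 - θ * h) ^ k) = 0 := by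
  obtain ⟨hθ0, hθ1⟩ := hθ
  obtain ⟨hl0, hl1⟩ := hlam
  obtain ⟨h0, h1⟩ := hh
  have hp : 0 < 1 + θ * h := by positivity
  have hm : 0 < 1 - θ * h := by nlinarith
  have hl : 0 < 1 - lam := by linarith
  have hden : 0 < (1 + lam) * (1 + θ * h) ^ k + (1 - lam) * (1 - θ * h) ^ k := by positivity
  rw [treeF, div_eq_iff hden.ne']
  constructor <;> intro H <;> linarith

/-- The logarithm of `(1 - x) / (1 + x) * ((1 + θ x) / (1 - θ x)) ^ k`. -/
def logRatio (k : ℕ) (θ x : ℝ) : ℝ :=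
  Real.log (1 - x) + k * Real.log (1 + θ * x) - Real.log (1 + x) - k * Real.log (1 - θ * x)

theorem hasDerivAt_logRatio (k : ℕ) {θ x : ℝ} (hθ : θ ∈ Set.Ioo (0 : ℝ) 1)
    (hx : x ∈ Set.Ico (0 : ℝ) 1) :
    HasDerivAt (logRatio k θ)
      (2 * ((k * θ - 1) - x ^ 2 * (k * θ - θ ^ 2)) / ((1 - x ^ 2) * (1 - (θ * x) ^ 2))) x := by
  obtain ⟨hθ0, hθ1⟩ := hθ
  obtain ⟨h0, h1⟩ := hx
  have h2 : 0 < 1 - x := by linarith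
  have h3 : 0 < 1 + x := by linarith
  have h4 : 0 < 1 + θ * x := by positivity
  have h5 : 0 < 1 - θ * x := by nlinarith
  have hid := hasDerivAt_id' x
  have d := (((hid.const_sub 1).log h2.ne').add
    ((((hid.const_mul θ).const_add 1).log h4.ne').const_mul (k : ℝ))).sub
    ((hid.const_add 1).log h3.ne') |>.sub
    ((((hid.const_mul θ).const_sub 1).log h5.ne').const_mul (k : ℝ))
  refine d.congr_deriv ?_
  rw [show (1 - x ^ 2) * (1 - (θ * x) ^ 2) =
    (1 - x) * (1 + x) * ((1 - θ * x) * (1 + θ * x)) by ring]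
  obtain ⟨q, hq⟩ : ∃ q, q = 1 - θ * x := ⟨_, rfl⟩
  rw [← hq] at h5 ⊢
  field_simp
  rw [hq]
  ring

theorem logRatio_eq_of_treeF_eq_self (k : ℕ) {θ lam h : ℝ} (hθ : θ ∈ Set.Ioo (0 : ℝ) 1)
    (hlam : lam ∈ Set.Ioo (0 : ℝ) 1) (hh : h ∈ Set.Ico (0 : ℝ) 1) (hfix : treeF k θ lam h = h) :
    logRatio k θ h = Real.log (1 - lam) - Real.log (1 + lam) := by
  have hP := (treeF_eq_self_iff k hθ hlam ⟨hh.1, hh.2.le⟩).1 hfix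
  obtain ⟨hθ0, hθ1⟩ := hθ
  obtain ⟨hl0, hl1⟩ := hlam
  obtain ⟨h0, h1⟩ := hh
  have h2 : 0 < 1 - h := by linarith
  have h3 : 0 < 1 + h := by linarith
  have h4 : 0 < 1 + θ * h := by positivity
  have h5 : 0 < 1 - θ * h := by nlinarith
  have h6 : 0 < 1 - lam := by linarith
  have h7 : 0 < 1 + lam := by linarith
  have hlog := congrArg Real.log (sub_eq_zero.1 hP)
  rw [Real.log_mul h2.ne' (by positivity), Real.log_mul h7.ne' (by positivity), Real.log_pow,
    Real.log_mul h3.ne' (by positivity), Real.log_mul h6.ne' (by positivity), Real.log_pow] at hlog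
  unfold logRatio
  linarith

/-- `logRatio` is unimodal on `[0,1)`, so it takes each negative value at most once there. -/
theorem logRatio_ne_of_lt {k : ℕ} (hk : 1 ≤ k) {θ a b : ℝ} (hθ : θ ∈ Set.Ioo (0 : ℝ) 1)
    (ha : 0 < a) (hab : a < b) (hb : b < 1) (hneg : logRatio k θ a < 0) :
    logRatio k θ a ≠ logRatio k θ b := by
  intro heq
  have hd := fun x (hx : x ∈ Set.Ico (0 : ℝ) 1) => hasDerivAt_logRatio k hθ hx
  obtain ⟨ξ, ⟨hξ0, hξa⟩, hξ⟩ := exists_hasDerivAt_eq_slope (logRatio k θ) _ ha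
    (fun x hx => (hd x ⟨hx.1, by linarith [hx.2]⟩).continuousAt.continuousWithinAt)
    (fun x hx => hd x ⟨hx.1.le, by linarith [hx.2]⟩)
  obtain ⟨η, ⟨hηa, hηb⟩, hη⟩ := exists_hasDerivAt_eq_slope (logRatio k θ) _ hab
    (fun x hx => (hd x ⟨by linarith [hx.1], by linarith [hx.2]⟩).continuousAt.continuousWithinAt)
    (fun x hx => hd x ⟨by linarith [hx.1], by linarith [hx.2]⟩)
  have hden : ∀ x : ℝ, 0 < x → x < 1 → 0 < (1 - x ^ 2) * (1 - (θ * x) ^ 2) := by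
    intro x hx0 hx1
    have h1 : 0 < θ * x := mul_pos hθ.1 hx0
    have h2 : θ * x < 1 := by nlinarith [hθ.2]
    exact mul_pos (by nlinarith) (by nlinarith)
  have hzero : logRatio k θ 0 = 0 := by simp [logRatio]
  have hξneg : 2 * ((k * θ - 1) - ξ ^ 2 * (k * θ - θ ^ 2)) < 0 := by
    have hslope : (logRatio k θ a - logRatio k θ 0) / (a - 0) < 0 :=
      div_neg_of_neg_of_pos (by linarith) (by linarith)
    rw [← hξ] at hslope
    exact (div_neg_iff.1 hslope).elim
      (fun h => absurd h.2 (hden ξ hξ0 (by linarith)).not_gt) (fun h => h.1)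
  have hηzero : 2 * ((k * θ - 1) - η ^ 2 * (k * θ - θ ^ 2)) = 0 := by
    rw [heq, sub_self, zero_div] at hη
    exact (div_eq_zero_iff.1 hη).resolve_right (hden η (by linarith) (by linarith)).ne'
  have hk' : (1 : ℝ) ≤ k := by exact_mod_cast hk
  have hcoef : 0 ≤ k * θ - θ ^ 2 := by nlinarith [hθ.1, hθ.2]
  have hsq : ξ ^ 2 ≤ η ^ 2 := by nlinarith
  nlinarith [mul_le_mul_of_nonneg_right hsq hcoef]

/-- For `k ≥ 1`, `θ ∈ (0,1)`, `λ ∈ (0,1)`, `f_{θ,λ}` has a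
unique fixed point `h*` in `[0,1]`, and moreover `h* ∈ (0,1)`. -/
theorem stmt_8 (k : ℕ) (hk : 1 ≤ k) (θ lam : ℝ)
    (hθ : θ ∈ Set.Ioo (0 : ℝ) 1) (hlam : lam ∈ Set.Ioo (0 : ℝ) 1) :
    ∃ h : ℝ, h ∈ Set.Ioo (0 : ℝ) 1 ∧ treeF k θ lam h = h ∧
      ∀ h' ∈ Set.Icc (0 : ℝ) 1, treeF k θ lam h' = h' → h' = h := by
  let P : ℝ → ℝ := fun h =>
    (1 - h) * ((1 + lam) * (1 + θ * h) ^ k) - (1 + h) * ((1 - lam) * (1 - θ * h) ^ k)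
  have hP0 : 0 < P 0 := by
    simp only [P, mul_zero, sub_zero, add_zero, one_pow]
    linarith [hlam.1]
  have hP1 : P 1 < 0 := by
    have h1 : 0 < (1 - θ * 1) ^ k := pow_pos (by linarith [hθ.2]) k
    have h2 : 0 < (1 - lam) * (1 - θ * 1) ^ k := mul_pos (by linarith [hlam.2]) h1
    simp only [P, sub_self, zero_mul]
    linarith
  have hmem : ∀ h ∈ Set.Icc (0 : ℝ) 1, treeF k θ lam h = h → h ∈ Set.Ioo (0 : ℝ) 1 := by
    intro h hh hfix
    have hP : P h = 0 := (treeF_eq_self_iff k hθ hlam hh).1 hfix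
    refine ⟨lt_of_le_of_ne hh.1 ?_, lt_of_le_of_ne hh.2 ?_⟩
    · rintro rfl
      exact hP0.ne' hP
    · rintro rfl
      exact hP1.ne hP
  have hcont : Continuous P := by fun_prop
  obtain ⟨h, hh, hPh⟩ := intermediate_value_Icc' zero_le_one hcont.continuousOn
    (show (0 : ℝ) ∈ Set.Icc (P 1) (P 0) from ⟨hP1.le, hP0.le⟩)
  have hfix := (treeF_eq_self_iff k hθ hlam hh).2 hPh
  have hlog : Real.log (1 - lam) - Real.log (1 + lam) < 0 :=
    sub_neg.2 (Real.log_lt_log (by linarith [hlam.2]) (by linarith [hlam.1]))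
  refine ⟨h, hmem h hh hfix, hfix, fun h' hh' hfix' => ?_⟩
  have hm := hmem h hh hfix
  have hm' := hmem h' hh' hfix'
  have he := logRatio_eq_of_treeF_eq_self k hθ hlam ⟨hm.1.le, hm.2⟩ hfix
  have he' := logRatio_eq_of_treeF_eq_self k hθ hlam ⟨hm'.1.le, hm'.2⟩ hfix'
  rcases lt_trichotomy h' h with hlt | heq | hgt
  · exact absurd (he'.trans he.symm) (logRatio_ne_of_lt hk hθ hm'.1 hlt hm.2 (he' ▸ hlog))
  · exact heq
  · exact absurd (he.trans he'.symm) (logRatio_ne_of_lt hk hθ hm.1 hgt hm'.2 (he ▸ hlog))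
end
end

section
/- Let k ≥ 1 be an integer, θ ∈ (0,1) and λ ∈ [0,1). Then for every h ∈ (−1,1), the derivative (d/dh) φ_{θ,λ}(h) has the same sign as f_{θ,λ}(h) − h; in particular (d/dh) φ_{θ,λ}(h) = 0 if and only if f_{θ,λ}(h) = h. -/
noncomputable section

/-- The free-energy functional `φ_{θ,λ}` for the Ising model on the random
`(k+1)`-regular graph. -/
def phiF (k : ℕ) (θ lam : ℝ) (h : ℝ) : ℝ :=
  -(((k : ℝ) + 1) / 2) * Real.log (1 + θ * h ^ 2) +
    Real.log ((1 + lam) * (1 + θ * h) ^ (k + 1) + (1 - lam) * (1 - θ * h) ^ (k + 1))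

/-- The derivative of `phiF` at `h` is a positive multiple of `treeF h - h`. -/
theorem exists_pos_hasDerivAt_phiF (k : ℕ) {θ lam h : ℝ}
    (hθ : θ ∈ Set.Ioo (0 : ℝ) 1) (hlam : lam ∈ Set.Ico (0 : ℝ) 1) (hh : h ∈ Set.Ioo (-1 : ℝ) 1) :
    ∃ c : ℝ, 0 < c ∧ HasDerivAt (phiF k θ lam) (c * (treeF k θ lam h - h)) h := by
  obtain ⟨hθ0, hθ1⟩ := hθ
  obtain ⟨hl0, hl1⟩ := hlam
  obtain ⟨hh0, hh1⟩ := hh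
  have hp : 0 < 1 + θ * h := by nlinarith
  have hm : 0 < 1 - θ * h := by nlinarith
  have hq : 0 < 1 + θ * h ^ 2 := by positivity
  have hA : 0 < (1 + lam) * (1 + θ * h) ^ k := by positivity
  have hB : 0 < (1 - lam) * (1 - θ * h) ^ k := mul_pos (by linarith) (by positivity)
  have hS := add_pos hA hB
  have hD : 0 < (1 + lam) * (1 + θ * h) ^ (k + 1) + (1 - lam) * (1 - θ * h) ^ (k + 1) := by
    simp only [pow_succ, ← mul_assoc]
    exact add_pos (mul_pos hA hp) (mul_pos hB hm)
  refine ⟨((k : ℝ) + 1) * θ * ((1 + lam) * (1 + θ * h) ^ k + (1 - lam) * (1 - θ * h) ^ k) /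
    ((1 + θ * h ^ 2) *
      ((1 + lam) * (1 + θ * h) ^ (k + 1) + (1 - lam) * (1 - θ * h) ^ (k + 1))),
    by positivity, ?_⟩
  have hlin : HasDerivAt (fun x : ℝ => θ * x) θ h := by
    simpa using (hasDerivAt_id h).const_mul θ
  have hlogq := ((((hasDerivAt_id h).pow 2).const_mul θ).const_add 1).log hq.ne'
  have hlogD := ((((hlin.const_add 1).pow (k + 1)).const_mul (1 + lam)).add
    (((hlin.const_sub 1).pow (k + 1)).const_mul (1 - lam))).log hD.ne'
  refine ((hlogq.const_mul (-(((k : ℝ) + 1) / 2))).add hlogD).congr_deriv ?_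
  simp only [treeF, id, Pi.add_apply, Pi.pow_apply, Nat.add_sub_cancel]
  push_cast
  rw [div_sub' hS.ne']
  field_simp
  ring

/-- For `k ≥ 1`, `θ ∈ (0,1)`, `λ ∈ [0,1)` and `h ∈ (−1,1)`,
the derivative of `φ_{θ,λ}` at `h` has the same sign as `f_{θ,λ}(h) − h`; in
particular it vanishes iff `f_{θ,λ}(h) = h`. -/
theorem stmt_10 (k : ℕ) (hk : 1 ≤ k) (θ lam : ℝ)
    (hθ : θ ∈ Set.Ioo (0 : ℝ) 1) (hlam : lam ∈ Set.Ico (0 : ℝ) 1) :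
    ∀ h ∈ Set.Ioo (-1 : ℝ) 1,
      (0 < deriv (phiF k θ lam) h ↔ h < treeF k θ lam h) ∧
      (deriv (phiF k θ lam) h < 0 ↔ treeF k θ lam h < h) ∧
      (deriv (phiF k θ lam) h = 0 ↔ treeF k θ lam h = h) := by
  intro h hh
  obtain ⟨c, hc, hderiv⟩ := exists_pos_hasDerivAt_phiF k hθ hlam hh
  rw [hderiv.deriv, mul_pos_iff_of_pos_left hc, sub_pos, ← smul_eq_mul,
    smul_neg_iff_of_pos_left hc, sub_neg, smul_eq_zero_iff_right hc.ne', sub_eq_zero]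
  exact ⟨Iff.rfl, Iff.rfl, Iff.rfl⟩
end
end

section
/- Let k ≥ 2 be an integer and θ ∈ (0,1) with kθ > 1. Then φ_{θ,0}(0) = log 2 and h = 0 is a strict local minimum of h ↦ φ_{θ,0}(h): there exists δ > 0 such that φ_{θ,0}(h) > log 2 for all h with 0 < |h| ≤ δ. -/
noncomputable section

/-- Second-order lower bounds for the even and odd parts of `(1 + x) ^ n`. -/
lemma even_odd_part_lower_bound (x : ℝ) (n : ℕ) :
    2 + (n : ℝ) * ((n : ℝ) - 1) * x ^ 2 ≤ (1 + x) ^ n + (1 - x) ^ n ∧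
      2 * (n : ℝ) * x ^ 2 ≤ x * ((1 + x) ^ n - (1 - x) ^ n) := by
  induction n with
  | zero => norm_num
  | succ n ih =>
    obtain ⟨hs, hd⟩ := ih
    have hn : 0 ≤ (n : ℝ) * ((n : ℝ) - 1) := by
      rcases n.eq_zero_or_pos with rfl | hn
      · simp
      · have : (1 : ℝ) ≤ n := by exact_mod_cast hn
        exact mul_nonneg (by positivity) (by linarith)
    have hs2 : 2 ≤ (1 + x) ^ n + (1 - x) ^ n := by
      linarith [mul_nonneg hn (sq_nonneg x)]
    have hm := mul_le_mul_of_nonneg_left hs2 (sq_nonneg x)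
    push_cast
    rw [pow_succ (1 + x), pow_succ (1 - x)]
    constructor <;> linarith

/-- If `b < a`, then `b * t < log (1 + a * t)` for all sufficiently small `t > 0`. -/
lemma mul_lt_log_one_add_mul {a b t : ℝ} (ha : 0 < a) (ht : 0 < t)
    (h : b * (1 + a * t) < a) : b * t < Real.log (1 + a * t) := by
  have hpos : 0 < 1 + a * t := by positivity
  refine lt_of_lt_of_le ?_ (Real.one_sub_inv_le_log_of_pos hpos)
  have heq : 1 - (1 + a * t)⁻¹ = a * t / (1 + a * t) := by
    field_simp
    ring
  rw [heq, lt_div_iff₀ hpos]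
  linarith [mul_lt_mul_of_pos_right h ht]

/-- For `k ≥ 2` and `θ ∈ (0,1)` with `kθ > 1`,
`φ_{θ,0}(0) = log 2` and `h = 0` is a strict local minimum of `φ_{θ,0}`. -/
theorem stmt_11 (k : ℕ) (hk : 2 ≤ k) (θ : ℝ)
    (hθ : θ ∈ Set.Ioo (0 : ℝ) 1) (hkθ : 1 < (k : ℝ) * θ) :
    phiF k θ 0 0 = Real.log 2 ∧
      ∃ δ > 0, ∀ h : ℝ, 0 < |h| → |h| ≤ δ → Real.log 2 < phiF k θ 0 h := by
  obtain ⟨hθ0, -⟩ := hθ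
  refine ⟨by norm_num [phiF], ?_⟩
  have hk0 : (0 : ℝ) < k := by exact_mod_cast (by omega : 0 < k)
  obtain ⟨b, hb⟩ : ∃ b : ℝ, b = ((k : ℝ) + 1) / 2 * θ := ⟨_, rfl⟩
  obtain ⟨a, ha⟩ : ∃ a : ℝ, a = b * (k * θ) := ⟨_, rfl⟩
  have hb0 : 0 < b := by rw [hb]; positivity
  have ha0 : 0 < a := by rw [ha]; positivity
  have hab : 0 < a - b := by
    rw [ha]
    linarith [mul_lt_mul_of_pos_left hkθ hb0]
  refine ⟨min 1 ((a - b) / (2 * (a * b))), by positivity, fun h hh hδ => ?_⟩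
  have h1 : |h| ≤ 1 := hδ.trans (min_le_left _ _)
  have h2 : |h| ≤ (a - b) / (2 * (a * b)) := hδ.trans (min_le_right _ _)
  have ht : 0 < h ^ 2 := by rw [← sq_abs]; positivity
  have hle : h ^ 2 ≤ |h| := by
    rw [← sq_abs]
    nlinarith
  have h3 : h ^ 2 * (2 * (a * b)) ≤ a - b :=
    (le_div_iff₀ (by positivity)).1 (hle.trans h2)
  have hlog : b * h ^ 2 < Real.log (1 + a * h ^ 2) :=
    mul_lt_log_one_add_mul ha0 ht (by linarith [mul_pos ht (mul_pos ha0 hb0)])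
  have hup : ((k : ℝ) + 1) / 2 * Real.log (1 + θ * h ^ 2) ≤ b * h ^ 2 := by
    have hl := Real.log_le_sub_one_of_pos (show 0 < 1 + θ * h ^ 2 by positivity)
    have hm := mul_le_mul_of_nonneg_left hl (show 0 ≤ ((k : ℝ) + 1) / 2 by positivity)
    rw [hb]
    linarith
  have hlow : Real.log 2 + Real.log (1 + a * h ^ 2) ≤
      Real.log ((1 + 0) * (1 + θ * h) ^ (k + 1) + (1 - 0) * (1 - θ * h) ^ (k + 1)) := by
    rw [← Real.log_mul two_ne_zero (by positivity)]
    refine Real.log_le_log (by positivity) ?_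
    have hp := (even_odd_part_lower_bound (θ * h) (k + 1)).1
    push_cast at hp
    rw [ha, hb]
    linarith
  rw [phiF, neg_mul]
  refine lt_neg_add_iff_add_lt.2 (lt_of_lt_of_le ?_ hlow)
  rw [add_comm]
  exact add_lt_add_right (hup.trans_lt hlog) _
end
end

section
/- Let k ≥ 2 be an integer and θ ∈ (0,1) with kθ > 1. Then there exists h* ∈ (0,1) such that f_{θ,0}(h*) = h* and φ_{θ,0}(h*) > log 2. -/
noncomputable section

/-- The numerator of `treeF k θ 0 h - h`, which carries the sign of the derivative of
`phiF k θ 0`. -/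
def treeGap (k : ℕ) (θ h : ℝ) : ℝ :=
  (1 - h) * (1 + θ * h) ^ k - (1 + h) * (1 - θ * h) ^ k

theorem hasDerivAt_treeGap_zero (k : ℕ) (θ : ℝ) :
    HasDerivAt (treeGap k θ) (2 * (k * θ - 1)) 0 := by
  have hl : HasDerivAt (fun h : ℝ => θ * h) θ 0 := by
    simpa using (hasDerivAt_id (0 : ℝ)).const_mul θ
  have hp := ((hasDerivAt_id (0 : ℝ)).const_sub 1).mul ((hl.const_add 1).pow k)
  have hm := ((hasDerivAt_id (0 : ℝ)).const_add 1).mul ((hl.const_sub 1).pow k)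
  refine (hp.sub hm).congr_deriv ?_
  simp
  ring

theorem hasDerivAt_phiF_zero (k : ℕ) {θ h : ℝ} (hθ : θ ∈ Set.Ioo (0 : ℝ) 1)
    (hh : h ∈ Set.Icc (0 : ℝ) 1) :
    HasDerivAt (phiF k θ 0)
      ((k + 1) * θ / ((1 + θ * h ^ 2) * ((1 + θ * h) ^ (k + 1) + (1 - θ * h) ^ (k + 1))) *
        treeGap k θ h) h := by
  obtain ⟨h0, h1⟩ := hθ
  obtain ⟨hh0, hh1⟩ := hh
  have hplus : 0 < 1 + θ * h := by positivity
  have hminus : 0 < 1 - θ * h := by nlinarith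
  have hD : 0 < 1 + θ * h ^ 2 := by positivity
  have hE : 0 < (1 + θ * h) ^ (k + 1) + (1 - θ * h) ^ (k + 1) := by positivity
  have hl : HasDerivAt (fun x : ℝ => θ * x) θ h := by
    simpa using (hasDerivAt_id h).const_mul θ
  have hq : HasDerivAt (fun x : ℝ => 1 + θ * x ^ 2) (θ * (2 * h)) h := by
    simpa using ((hasDerivAt_pow 2 h).const_mul θ).const_add 1
  have hs : HasDerivAt (fun x : ℝ => (1 + θ * x) ^ (k + 1) + (1 - θ * x) ^ (k + 1))
      ((k + 1) * θ * ((1 + θ * h) ^ k - (1 - θ * h) ^ k)) h := by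
    refine (((hl.const_add 1).pow (k + 1)).add ((hl.const_sub 1).pow (k + 1))).congr_deriv ?_
    push_cast
    ring
  have hfun : phiF k θ 0 = fun x : ℝ => -(((k : ℝ) + 1) / 2) * Real.log (1 + θ * x ^ 2) +
      Real.log ((1 + θ * x) ^ (k + 1) + (1 - θ * x) ^ (k + 1)) := by
    funext x
    simp [phiF]
  rw [hfun]
  refine (((hq.log hD.ne').const_mul _).add (hs.log hE.ne')).congr_deriv ?_
  have hD' := hD.ne'
  have hE' := hE.ne'
  rw [treeGap, div_mul_eq_mul_div, ← mul_div_assoc, div_add_div _ _ hD' hE']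
  congr 1
  ring

theorem treeF_eq_self_of_treeGap_eq_zero (k : ℕ) {θ h : ℝ} (hθ : θ ∈ Set.Ioo (0 : ℝ) 1)
    (hh : h ∈ Set.Icc (0 : ℝ) 1) (hgap : treeGap k θ h = 0) : treeF k θ 0 h = h := by
  obtain ⟨h0, h1⟩ := hθ
  obtain ⟨hh0, hh1⟩ := hh
  have hplus : 0 < 1 + θ * h := by positivity
  have hminus : 0 < 1 - θ * h := by nlinarith
  have hE : 0 < (1 + θ * h) ^ k + (1 - θ * h) ^ k := by positivity
  simp only [treeF, add_zero, sub_zero, one_mul]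
  rw [div_eq_iff hE.ne']
  unfold treeGap at hgap
  linarith

theorem exists_log_two_lt_phiF (k : ℕ) {θ : ℝ} (hθ : θ ∈ Set.Ioo (0 : ℝ) 1)
    (hkθ : 1 < (k : ℝ) * θ) :
    ∃ h ∈ Set.Icc (0 : ℝ) 1, Real.log 2 < phiF k θ 0 h := by
  have hd := hasDerivAt_treeGap_zero k θ
  have hsign := eventually_nhdsWithin_sign_eq_of_deriv_pos (f := treeGap k θ) (x₀ := 0)
    (by rw [hd.deriv]; linarith) (by simp [treeGap])
  obtain ⟨ε, hε, hball⟩ := Metric.eventually_nhds_iff.1 hsign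
  set δ := min (ε / 2) 1
  have hδ0 : 0 < δ := by positivity
  have hδ1 : δ ≤ 1 := min_le_right _ _
  have hδε : δ < ε := (min_le_left _ _).trans_lt (by linarith)
  have hsub : Set.Icc 0 δ ⊆ Set.Icc (0 : ℝ) 1 := Set.Icc_subset_Icc le_rfl hδ1
  have hmono : StrictMonoOn (phiF k θ 0) (Set.Icc 0 δ) := by
    refine strictMonoOn_of_deriv_pos (convex_Icc 0 δ)
      (fun x hx => (hasDerivAt_phiF_zero k hθ (hsub hx)).continuousAt.continuousWithinAt) ?_
    intro x hx
    rw [interior_Icc] at hx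
    have hx' := hsub (Set.Ioo_subset_Icc_self hx)
    rw [(hasDerivAt_phiF_zero k hθ hx').deriv]
    have hgap : 0 < treeGap k θ x := by
      have := hball (y := x) (by
        rw [Real.dist_eq, sub_zero, abs_of_pos hx.1]
        exact hx.2.trans hδε)
      rw [sub_zero, sign_pos hx.1] at this
      exact sign_eq_one_iff.1 this
    have h0 := hθ.1
    have hx0 := hx.1
    have hminus : 0 < 1 - θ * x := by nlinarith [hθ.2, hx'.2]
    positivity
  refine ⟨δ, hsub (Set.right_mem_Icc.2 hδ0.le), ?_⟩
  have := hmono (Set.left_mem_Icc.2 hδ0.le) (Set.right_mem_Icc.2 hδ0.le) hδ0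
  have hzero : phiF k θ 0 0 = Real.log 2 := by
    norm_num [phiF]
  rwa [hzero] at this

theorem exists_phiF_one_lt (k : ℕ) {θ : ℝ} (hθ : θ ∈ Set.Ioo (0 : ℝ) 1) :
    ∃ h ∈ Set.Icc (0 : ℝ) 1, phiF k θ 0 1 < phiF k θ 0 h := by
  have hd := (hasDerivAt_phiF_zero k hθ (Set.right_mem_Icc.2 zero_le_one)).sub_const
    (phiF k θ 0 1)
  have hneg : deriv (fun x => phiF k θ 0 x - phiF k θ 0 1) 1 < 0 := by
    rw [hd.deriv]
    have h0 := hθ.1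
    have hminus : 0 < 1 - θ * 1 := by linarith [hθ.2]
    refine mul_neg_of_pos_of_neg (by positivity) ?_
    have : 0 < (1 - θ * 1) ^ k := by positivity
    unfold treeGap
    linarith
  obtain ⟨ε, hε, hball⟩ := Metric.eventually_nhds_iff.1
    (eventually_nhdsWithin_sign_eq_of_deriv_neg hneg (by simp))
  have hδ0 : 0 < min (ε / 2) 1 := by positivity
  have hδ1 : min (ε / 2) 1 ≤ 1 := min_le_right _ _
  have hδε : min (ε / 2) 1 < ε := (min_le_left _ _).trans_lt (by linarith)
  refine ⟨1 - min (ε / 2) 1, ⟨by linarith, by linarith⟩, ?_⟩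
  have := hball (y := 1 - min (ε / 2) 1) (by
    rw [Real.dist_eq, sub_sub_cancel_left, abs_neg, abs_of_pos hδ0]
    exact hδε)
  rw [sub_sub_cancel, sign_pos hδ0, sign_eq_one_iff] at this
  linarith

/-- For `k ≥ 2` and `θ ∈ (0,1)` with `kθ > 1`, there is a
fixed point `h* ∈ (0,1)` of `f_{θ,0}` with `φ_{θ,0}(h*) > log 2`. -/
theorem stmt_12 (k : ℕ) (hk : 2 ≤ k) (θ : ℝ)
    (hθ : θ ∈ Set.Ioo (0 : ℝ) 1) (hkθ : 1 < (k : ℝ) * θ) :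
    ∃ h : ℝ, h ∈ Set.Ioo (0 : ℝ) 1 ∧ treeF k θ 0 h = h ∧
      Real.log 2 < phiF k θ 0 h := by
  obtain ⟨x, hx, hmax⟩ := isCompact_Icc.exists_isMaxOn
    (Set.nonempty_Icc.2 (zero_le_one' ℝ))
    (fun y hy => (hasDerivAt_phiF_zero k hθ hy).continuousAt.continuousWithinAt)
  obtain ⟨a, ha, hlog⟩ := exists_log_two_lt_phiF k hθ hkθ
  obtain ⟨b, hb, hone⟩ := exists_phiF_one_lt k hθ
  have hlogx : Real.log 2 < phiF k θ 0 x := hlog.trans_le (hmax ha)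
  have hx0 : x ≠ 0 := by
    rintro rfl
    norm_num [phiF] at hlogx
  have hx1 : x ≠ 1 := by
    rintro rfl
    exact absurd (hmax hb) (not_le.2 hone)
  have hxI : x ∈ Set.Ioo (0 : ℝ) 1 := ⟨hx.1.lt_of_ne' hx0, hx.2.lt_of_ne hx1⟩
  refine ⟨x, hxI, treeF_eq_self_of_treeGap_eq_zero k hθ hx ?_, hlogx⟩
  have hcrit := (hmax.isLocalMax (Icc_mem_nhds hxI.1 hxI.2)).hasDerivAt_eq_zero
    (hasDerivAt_phiF_zero k hθ hx)
  refine (mul_eq_zero.1 hcrit).resolve_left (ne_of_gt ?_)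
  have h0 := hθ.1
  have hpos := hxI.1
  have hminus : 0 < 1 - θ * x := by nlinarith [hθ.2, hx.2]
  positivity
end
end

section
/- Let k ≥ 1 and t ≥ 0 be integers, θ ∈ (0,1), λ ∈ [0,1), h₀ ∈ [−1,1]. Let T be the rooted k-ary tree of depth t: its vertex set is the set of finite sequences over {1,…,k} of length ≤ t, the root r is the empty sequence, every vertex of length < t has exactly k children (its one-element extensions), and the leaves are the length-t vertices. Define a probability distribution on configurations σ : V(T) → {−1,+1} by P(σ) ∝ Π_{(v,c) parent–child edge}(1+θσ_vσ_c) · Π_{v non-leaf}(1+λσ_v) · Π_{ℓ leaf}(1+h₀σ_ℓ) (the normalization constant is strictly positive). Then P(σ_r = +1) = (1 + f_{θ,λ}^{∘t}(h₀))/2. -/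
noncomputable section

/-- The spin value `±1` associated to a Boolean. -/
def spin (b : Bool) : ℝ := if b then 1 else -1

/-- Spin configurations of the rooted `k`-ary tree of depth `t`, organized by
level: the vertices at depth `m` are the paths `Fin m → Fin k` from the root
(the root is the empty path at level `m = 0`). -/
def Cfg (k t : ℕ) : Type := ∀ m : Fin (t + 1), (Fin (m : ℕ) → Fin k) → Bool

instance (k t : ℕ) : Fintype (Cfg k t) := by unfold Cfg; infer_instance
instance (k t : ℕ) : DecidableEq (Cfg k t) := by unfold Cfg; infer_instance

/-- The spin at the root (the empty path at level `0`). -/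
def rootB (k t : ℕ) (σ : Cfg k t) : Bool := σ ⟨0, Nat.succ_pos t⟩ Fin.elim0

/-- Product of the edge factors `1 + θ σ_v σ_c` over all parent–child edges:
the child at level `m+1` with path `q` has parent the level-`m` restriction of
`q`. -/
def edgeProd (k t : ℕ) (θ : ℝ) (σ : Cfg k t) : ℝ :=
  ∏ m : Fin t, ∏ q : Fin ((m : ℕ) + 1) → Fin k,
    (1 + θ * spin (σ ⟨(m : ℕ), Nat.lt_succ_of_lt m.isLt⟩
          (fun i => q ⟨(i : ℕ), Nat.lt_succ_of_lt i.isLt⟩)) *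
        spin (σ ⟨(m : ℕ) + 1, Nat.succ_lt_succ m.isLt⟩ q))

/-- Product of the factors `1 + λ σ_v` over the non-leaf vertices (levels
`0, …, t−1`). -/
def innerProd (k t : ℕ) (lam : ℝ) (σ : Cfg k t) : ℝ :=
  ∏ m : Fin t, ∏ p : Fin (m : ℕ) → Fin k,
    (1 + lam * spin (σ ⟨(m : ℕ), Nat.lt_succ_of_lt m.isLt⟩ p))

/-- Product of the factors `1 + h₀ σ_ℓ` over the leaves (level `t`). -/
def leafProd (k t : ℕ) (h₀ : ℝ) (σ : Cfg k t) : ℝ :=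
  ∏ p : Fin t → Fin k, (1 + h₀ * spin (σ ⟨t, Nat.lt_succ_self t⟩ p))

/-- Product of the factors `1 + λ σ_v` over all vertices of the tree. -/
def allVertexProd (k t : ℕ) (lam : ℝ) (σ : Cfg k t) : ℝ :=
  ∏ m : Fin (t + 1), ∏ p : Fin (m : ℕ) → Fin k, (1 + lam * spin (σ m p))

/-- All leaves (depth-`t` vertices) carry spin `+1`. -/
def leavesTrue (k t : ℕ) (σ : Cfg k t) : Prop :=
  ∀ p : Fin t → Fin k, σ ⟨t, Nat.lt_succ_self t⟩ p = true

instance (k t : ℕ) (σ : Cfg k t) : Decidable (leavesTrue k t σ) := by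
  unfold leavesTrue; infer_instance

/-- Configurations on the tree of depth `t + 1` are pairs of a configuration of the spins at the
leaves and a configuration on the tree of depth `t`. -/
def cfgSnocEquiv (k t : ℕ) :
    ((Fin (t + 1) → Fin k) → Bool) × Cfg k t ≃ Cfg k (t + 1) :=
  Fin.snocEquiv fun m : Fin (t + 2) => (Fin (m : ℕ) → Fin k) → Bool

lemma cfgSnocEquiv_apply_of_lt {k t : ℕ} (x : ((Fin (t + 1) → Fin k) → Bool) × Cfg k t) (m : ℕ)
    (hm : m < t + 1) (hm' : m < t + 2) (p : Fin m → Fin k) :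
    cfgSnocEquiv k t x ⟨m, hm'⟩ p = x.2 ⟨m, hm⟩ p :=
  congrFun (Fin.snoc_castSucc (α := fun m : Fin (t + 2) => (Fin (m : ℕ) → Fin k) → Bool)
    x.1 x.2 ⟨m, hm⟩) p

lemma cfgSnocEquiv_apply_last {k t : ℕ} (x : ((Fin (t + 1) → Fin k) → Bool) × Cfg k t)
    (h : t + 1 < t + 2) (q : Fin (t + 1) → Fin k) :
    cfgSnocEquiv k t x ⟨t + 1, h⟩ q = x.1 q :=
  congrFun (Fin.snoc_last (α := fun m : Fin (t + 2) => (Fin (m : ℕ) → Fin k) → Bool)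
    x.1 x.2) q

lemma rootB_cfgSnocEquiv {k t : ℕ} (x : ((Fin (t + 1) → Fin k) → Bool) × Cfg k t) :
    rootB k (t + 1) (cfgSnocEquiv k t x) = rootB k t x.2 :=
  cfgSnocEquiv_apply_of_lt x 0 _ _ _

lemma edgeProd_cfgSnocEquiv {k t : ℕ} (θ : ℝ) (x : ((Fin (t + 1) → Fin k) → Bool) × Cfg k t) :
    edgeProd k (t + 1) θ (cfgSnocEquiv k t x) = edgeProd k t θ x.2 *
      ∏ q : Fin (t + 1) → Fin k,
        (1 + θ * spin (x.2 ⟨t, t.lt_succ_self⟩ fun i => q i.castSucc) * spin (x.1 q)) := by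
  unfold edgeProd
  rw [Fin.prod_univ_castSucc]
  congr 1
  · refine Finset.prod_congr rfl fun m _ => Finset.prod_congr rfl fun q _ => ?_
    erw [cfgSnocEquiv_apply_of_lt x m (by omega), cfgSnocEquiv_apply_of_lt x (m + 1) (by omega)]
    rfl
  · refine Finset.prod_congr rfl fun q _ => ?_
    erw [cfgSnocEquiv_apply_of_lt x t (by omega), cfgSnocEquiv_apply_last x]
    rfl

lemma innerProd_cfgSnocEquiv {k t : ℕ} (lam : ℝ)
    (x : ((Fin (t + 1) → Fin k) → Bool) × Cfg k t) :
    innerProd k (t + 1) lam (cfgSnocEquiv k t x) = innerProd k t lam x.2 *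
      ∏ p : Fin t → Fin k, (1 + lam * spin (x.2 ⟨t, t.lt_succ_self⟩ p)) := by
  unfold innerProd
  rw [Fin.prod_univ_castSucc]
  congr 1
  · refine Finset.prod_congr rfl fun m _ => Finset.prod_congr rfl fun q _ => ?_
    erw [cfgSnocEquiv_apply_of_lt x m (by omega)]
  · refine Finset.prod_congr rfl fun q _ => ?_
    erw [cfgSnocEquiv_apply_of_lt x t (by omega)]

lemma leafProd_cfgSnocEquiv {k t : ℕ} (h : ℝ) (x : ((Fin (t + 1) → Fin k) → Bool) × Cfg k t) :
    leafProd k (t + 1) h (cfgSnocEquiv k t x) =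
      ∏ q : Fin (t + 1) → Fin k, (1 + h * spin (x.1 q)) :=
  Finset.prod_congr rfl fun q _ => by rw [cfgSnocEquiv_apply_last x]

/-- A product over paths of length `t + 1` whose factors depend only on the parent. -/
lemma prod_path_castSucc {k t : ℕ} (u : (Fin t → Fin k) → ℝ) :
    ∏ q : Fin (t + 1) → Fin k, u (fun i => q i.castSucc) = ∏ p, u p ^ k := by
  rw [← (Fin.snocEquiv fun _ : Fin (t + 1) => Fin k).prod_comp, Fintype.prod_prod_type_right]
  refine Finset.prod_congr rfl fun p _ => ?_
  simp [Fin.snocEquiv]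

/-- Summing over the spins of the leaves attached to given parent spins `s`. -/
lemma sum_leaf_spins {k t : ℕ} (θ h : ℝ) (s : (Fin t → Fin k) → ℝ) :
    ∑ τ : (Fin (t + 1) → Fin k) → Bool, ∏ q : Fin (t + 1) → Fin k,
      ((1 + θ * s (fun i => q i.castSucc) * spin (τ q)) * (1 + h * spin (τ q))) =
      ∏ p, (2 * (1 + θ * h * s p)) ^ k := by
  rw [← prod_path_castSucc fun p => 2 * (1 + θ * h * s p)]
  rw [← Fintype.prod_sum fun (q : Fin (t + 1) → Fin k) (b : Bool) =>
    (1 + θ * s (fun i => q i.castSucc) * spin b) * (1 + h * spin b)]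
  refine Finset.prod_congr rfl fun q _ => ?_
  simp only [Fintype.sum_bool, spin, if_true, Bool.false_eq_true, if_false]
  ring

section TreeRecursion

variable {θ lam h : ℝ}

lemma one_add_mul_pos_of_mem (hθ : θ ∈ Set.Ioo (0 : ℝ) 1) (hh : h ∈ Set.Icc (-1 : ℝ) 1) :
    0 < 1 + θ * h := by
  nlinarith [hθ.1, hθ.2, hh.1, hh.2]

lemma one_sub_mul_pos_of_mem (hθ : θ ∈ Set.Ioo (0 : ℝ) 1) (hh : h ∈ Set.Icc (-1 : ℝ) 1) :
    0 < 1 - θ * h := by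
  nlinarith [hθ.1, hθ.2, hh.1, hh.2]

lemma treeF_mem_Icc (k : ℕ) (hθ : θ ∈ Set.Ioo (0 : ℝ) 1) (hlam : lam ∈ Set.Ico (0 : ℝ) 1)
    (hh : h ∈ Set.Icc (-1 : ℝ) 1) : treeF k θ lam h ∈ Set.Icc (-1 : ℝ) 1 := by
  have ha : 0 < (1 + lam) * (1 + θ * h) ^ k :=
    mul_pos (by linarith [hlam.1]) (pow_pos (one_add_mul_pos_of_mem hθ hh) k)
  have hb : 0 < (1 - lam) * (1 - θ * h) ^ k :=
    mul_pos (by linarith [hlam.2]) (pow_pos (one_sub_mul_pos_of_mem hθ hh) k)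
  unfold treeF
  rw [Set.mem_Icc, le_div_iff₀ (by positivity), div_le_iff₀ (by positivity)]
  constructor <;> linarith

/-- Summing out the children of a vertex replaces its field `lam` by `treeF k θ lam h`. -/
lemma exists_treeF_factor (k : ℕ) (hθ : θ ∈ Set.Ioo (0 : ℝ) 1) (hlam : lam ∈ Set.Ico (0 : ℝ) 1)
    (hh : h ∈ Set.Icc (-1 : ℝ) 1) :
    ∃ c : ℝ, 0 < c ∧ ∀ b : Bool, (1 + lam * spin b) * (2 * (1 + θ * h * spin b)) ^ k =
      c * (1 + treeF k θ lam h * spin b) := by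
  have ha : 0 < (1 + lam) * (1 + θ * h) ^ k :=
    mul_pos (by linarith [hlam.1]) (pow_pos (one_add_mul_pos_of_mem hθ hh) k)
  have hb : 0 < (1 - lam) * (1 - θ * h) ^ k :=
    mul_pos (by linarith [hlam.2]) (pow_pos (one_sub_mul_pos_of_mem hθ hh) k)
  have hne : (1 + lam) * (1 + θ * h) ^ k + (1 - lam) * (1 - θ * h) ^ k ≠ 0 := by positivity
  refine ⟨2 ^ k * (((1 + lam) * (1 + θ * h) ^ k + (1 - lam) * (1 - θ * h) ^ k) / 2),
    by positivity, fun b => ?_⟩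
  unfold treeF
  cases b
  · simp only [spin, Bool.false_eq_true, if_false, mul_neg, mul_one, mul_pow, ← sub_eq_add_neg]
    field_simp
    ring
  · simp only [spin, if_true, mul_one, mul_pow]
    field_simp
    ring

/-- The unnormalized root marginal is proportional to `1 + (treeF k θ lam)^[t] h * spin b`. -/
lemma exists_root_marginal (k t : ℕ) (hθ : θ ∈ Set.Ioo (0 : ℝ) 1)
    (hlam : lam ∈ Set.Ico (0 : ℝ) 1) (hh : h ∈ Set.Icc (-1 : ℝ) 1) :
    ∃ C : ℝ, 0 < C ∧ ∀ g : Bool → ℝ,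
      ∑ σ : Cfg k t, g (rootB k t σ) *
        (edgeProd k t θ σ * innerProd k t lam σ * leafProd k t h σ) =
      C * ∑ b : Bool, g b * (1 + (treeF k θ lam)^[t] h * spin b) := by
  induction t generalizing h with
  | zero =>
    refine ⟨1, one_pos, fun g => ?_⟩
    let e : Cfg k 0 ≃ Bool :=
      { toFun := rootB k 0
        invFun := fun b _ _ => b
        left_inv := fun σ => by
          funext m p
          obtain ⟨m, hm⟩ := m
          obtain rfl : m = 0 := by omega
          exact congrArg (σ ⟨0, hm⟩) (Subsingleton.elim _ _)
        right_inv := fun b => rfl }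
    rw [one_mul, ← e.sum_comp]
    refine Finset.sum_congr rfl fun σ _ => ?_
    have hleaf : leafProd k 0 h σ = 1 + h * spin (e σ) := by
      unfold leafProd
      rw [Fintype.prod_unique]
      exact congrArg (fun p => 1 + h * spin (σ ⟨0, Nat.lt_succ_self 0⟩ p)) (Subsingleton.elim _ _)
    have he : rootB k 0 σ = e σ := rfl
    rw [hleaf, he]
    simp [edgeProd, innerProd]
  | succ t ih =>
    obtain ⟨c, hc, hcb⟩ := exists_treeF_factor k hθ hlam hh
    obtain ⟨C, hC, hCg⟩ := ih (treeF_mem_Icc k hθ hlam hh)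
    refine ⟨c ^ Fintype.card (Fin t → Fin k) * C, by positivity, fun g => ?_⟩
    rw [Function.iterate_succ_apply, mul_assoc, ← hCg g, Finset.mul_sum,
      ← (cfgSnocEquiv k t).sum_comp, Fintype.sum_prod_type_right]
    refine Finset.sum_congr rfl fun σ _ => ?_
    have key := sum_leaf_spins θ h fun p => spin (σ ⟨t, t.lt_succ_self⟩ p)
    have hfac : (∏ p : Fin t → Fin k, (1 + lam * spin (σ ⟨t, t.lt_succ_self⟩ p))) *
        ∏ p : Fin t → Fin k, (2 * (1 + θ * h * spin (σ ⟨t, t.lt_succ_self⟩ p))) ^ k =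
        c ^ Fintype.card (Fin t → Fin k) * leafProd k t (treeF k θ lam h) σ := by
      rw [← Finset.prod_mul_distrib, Finset.prod_congr rfl fun p _ => hcb _,
        Finset.prod_mul_distrib, Finset.prod_const, Finset.card_univ]
      rfl
    calc _ = ∑ τ : (Fin (t + 1) → Fin k) → Bool, g (rootB k t σ) * edgeProd k t θ σ *
          innerProd k t lam σ *
          (∏ p : Fin t → Fin k, (1 + lam * spin (σ ⟨t, t.lt_succ_self⟩ p))) *
          ∏ q : Fin (t + 1) → Fin k,
            ((1 + θ * spin (σ ⟨t, t.lt_succ_self⟩ fun i => q i.castSucc) * spin (τ q)) *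
              (1 + h * spin (τ q))) := by
          refine Finset.sum_congr rfl fun τ _ => ?_
          rw [rootB_cfgSnocEquiv, edgeProd_cfgSnocEquiv, innerProd_cfgSnocEquiv,
            leafProd_cfgSnocEquiv, Finset.prod_mul_distrib]
          ring
      _ = _ := by
          rw [← Finset.mul_sum, key, mul_assoc, hfac]
          ring

end TreeRecursion

/-- For the Ising model on the rooted `k`-ary tree of depth
`t`, with edge factors `1+θσ_vσ_c`, field factors `1+λσ_v` on non-leaf
vertices and boundary factors `1+h₀σ_ℓ` on leaves (the normalization being
strictly positive), the probability that the root spin is `+1` equals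
`(1 + f_{θ,λ}^{∘t}(h₀))/2`. -/
theorem stmt_15 (k t : ℕ) (hk : 1 ≤ k) (θ lam h₀ : ℝ)
    (hθ : θ ∈ Set.Ioo (0 : ℝ) 1) (hlam : lam ∈ Set.Ico (0 : ℝ) 1)
    (hh : h₀ ∈ Set.Icc (-1 : ℝ) 1) :
    0 < (∑ σ : Cfg k t, edgeProd k t θ σ * innerProd k t lam σ * leafProd k t h₀ σ) ∧
    (∑ σ : Cfg k t, if rootB k t σ = true
        then edgeProd k t θ σ * innerProd k t lam σ * leafProd k t h₀ σ else 0) /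
      (∑ σ : Cfg k t, edgeProd k t θ σ * innerProd k t lam σ * leafProd k t h₀ σ) =
      (1 + (treeF k θ lam)^[t] h₀) / 2 := by
  obtain ⟨C, hC, hg⟩ := exists_root_marginal k t hθ hlam hh
  have hZ := hg fun _ => 1
  have hP := hg fun b => if b = true then 1 else 0
  simp only [one_mul, ite_mul, zero_mul, Fintype.sum_bool, spin, if_true, Bool.false_eq_true,
    if_false] at hZ hP
  rw [hZ, hP]
  refine ⟨by linarith, ?_⟩
  field_simp
  ring
end
end
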